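/- arXiv:2106.11590 — 3 statements merged into one kernel-verified Lean document; each statement's English description precedes it below -/
import Mathlib

section
/- Let d be a positive squarefree integer with d ≡ 3 (mod 4) and n ≥ 1. Let O = ℤ[ω] where ω = (1+√-d)/2 satisfies ω² = ω - (1+d)/4, with conjugation the ring automorphism σ determined by σ(ω) = 1-ω. Let R = O/(8) with σ the induced endomorphism, and let M = diag(1,…,1,-2) of size n+1. Then the number N of matrices A ∈ M_{n+1}(R) with A·M·σ(A)ᵀ = M and det A = 1 satisfies, as rational numbers, N = 2^{3(n+1)²-3} · ∏_{i=1}^{n} (1 - χ₈(-d)^i · 2^{-i}), where χ₈(m) = 1 if m ≡ ±1 (mod 8) and χ₈(m) = -1 if m ≡ ±3 (mod 8). -/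
open Matrix Polynomial

/-- The ring `O = ℤ[ω]` where `ω = (1+√-d)/2` satisfies `ω² = ω - (1+d)/4`,
realized as `ℤ[X]/(X² - X + (1+d)/4)`. -/
abbrev Og (d : ℤ) : Type := AdjoinRoot (X ^ 2 - X + C ((1 + d) / 4) : ℤ[X])

/-- Conjugation on `O = ℤ[ω]`, the ring endomorphism determined by `ω ↦ 1 - ω`. -/
noncomputable def conjOg (d : ℤ) : Og d →+* Og d :=
  AdjoinRoot.lift (AdjoinRoot.of _) (1 - AdjoinRoot.root _)
    (by
      have h := AdjoinRoot.eval₂_root (X ^ 2 - X + C ((1 + d) / 4) : ℤ[X])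
      simp only [Polynomial.eval₂_add, Polynomial.eval₂_sub, Polynomial.eval₂_pow,
        Polynomial.eval₂_X, Polynomial.eval₂_C] at h ⊢
      linear_combination h)

/-- The quotient ring `O/(m)`. -/
abbrev ROg (d m : ℤ) : Type := Og d ⧸ Ideal.span {(m : Og d)}

/-- Conjugation descends to the quotient `O/(m)`. -/
noncomputable def conjROg (d m : ℤ) : ROg d m →+* ROg d m :=
  Ideal.quotientMap (Ideal.span {(m : Og d)}) (conjOg d)
    (by
      rw [Ideal.span_singleton_le_iff_mem, Ideal.mem_comap, map_intCast]
      exact Ideal.mem_span_singleton_self _)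

/-- The diagonal matrix `diag(1, …, 1, -2)` of size `n+1`. -/
def Mmat (R : Type*) [Ring R] (n : ℕ) : Matrix (Fin (n + 1)) (Fin (n + 1)) R :=
  Matrix.diagonal fun i => if i = Fin.last n then -2 else 1

section Blocks

variable {S : Type*} [CommRing S] {n : ℕ}

lemma eq_smul_one_of_fin_one (X : Matrix (Fin 1) (Fin 1) S) : X = X 0 0 • 1 := by
  ext i j
  fin_cases i; fin_cases j; simp

lemma isUnit_one_add_two_smul {ι : Type*} [Fintype ι] [DecidableEq ι] (h8 : (8 : S) = 0)
    (K : Matrix ι ι S) : IsUnit (1 + (2 : S) • K) := by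
  apply IsNilpotent.isUnit_one_add
  refine ⟨3, ?_⟩
  rw [_root_.smul_pow, show (2 : S) ^ 3 = 0 by rw [← h8]; norm_num, zero_smul]

variable [StarRing S]

lemma star_two_smul {m p : Type*} (X : Matrix m p S) : ((2 : S) • X)ᴴ = (2 : S) • Xᴴ := by
  rw [conjTranspose_smul, star_ofNat]

/-- For `P Pᴴ = 1 + 2 q qᴴ`, the Schur-complement scalar `1 - 2 qᴴ (P Pᴴ)⁻¹ q` is the inverse of
`det P * star (det P)`. -/
lemma det_mul_star_det_mul_schur {P G : Matrix (Fin n) (Fin n) S} {q : Matrix (Fin n) (Fin 1) S}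
    (h : P * Pᴴ = 1 + (2 : S) • (q * qᴴ)) (hG : G * (P * Pᴴ) = 1) :
    P.det * star P.det * (1 - 2 * (qᴴ * (G * q)) 0 0) = 1 := by
  have h1 : P.det * star P.det = 1 + 2 * (qᴴ * q) 0 0 := by
    rw [← det_conjTranspose, ← det_mul, h, ← smul_mul, det_one_add_mul_comm]
    simp
  have h2 : qᴴ * (G * q) + (2 : S) • (qᴴ * (G * q) * (qᴴ * q)) = qᴴ * q := by
    have : qᴴ * (G * (P * Pᴴ)) * q = qᴴ * q := by rw [hG, Matrix.mul_one]
    rw [h] at this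
    simpa [Matrix.mul_add, Matrix.add_mul, Matrix.mul_assoc] using this
  have h3 := congrFun (congrFun h2 0) 0
  simp only [Matrix.add_apply, Matrix.smul_apply, smul_eq_mul] at h3
  rw [Matrix.mul_apply (M := qᴴ * (G * q))] at h3
  simp only [Finset.univ_unique, Fin.default_eq_zero, Fin.isValue, Finset.sum_singleton] at h3
  rw [h1]
  linear_combination -2 * h3

/-- The form `diag(1, …, 1, -2)` in block shape. -/
def blockForm (S : Type*) [CommRing S] (n : ℕ) : Matrix (Fin n ⊕ Fin 1) (Fin n ⊕ Fin 1) S :=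
  fromBlocks 1 0 0 ((-2 : S) • 1)

lemma blockForm_unitary_iff (P : Matrix (Fin n) (Fin n) S) (q : Matrix (Fin n) (Fin 1) S)
    (r : Matrix (Fin 1) (Fin n) S) (s : Matrix (Fin 1) (Fin 1) S) :
    fromBlocks P q r s * blockForm S n * (fromBlocks P q r s)ᴴ = blockForm S n ↔
      P * Pᴴ = 1 + (2 : S) • (q * qᴴ) ∧ P * rᴴ = (2 : S) • (q * sᴴ) ∧
      r * Pᴴ = (2 : S) • (s * qᴴ) ∧ r * rᴴ + (2 : S) • 1 = (2 : S) • (s * sᴴ) := by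
  rw [blockForm, fromBlocks_conjTranspose, fromBlocks_multiply, fromBlocks_multiply,
    fromBlocks_inj]
  simp only [Matrix.mul_one, Matrix.mul_zero, add_zero, zero_add, Matrix.mul_smul,
    Matrix.smul_mul, neg_smul, Matrix.mul_neg, Matrix.neg_mul]
  simp only [← sub_eq_add_neg, sub_eq_zero]
  refine and_congr sub_eq_iff_eq_add (and_congr Iff.rfl (and_congr Iff.rfl ?_))
  rw [sub_eq_iff_eq_add, ← sub_eq_neg_add, eq_sub_iff_add_eq]

/-- The bottom rows of a special unitary matrix for `blockForm` are determined by its top rows. -/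
lemma bottom_eq_of_unitary (P : Matrix (Fin n) (Fin n) S) (q : Matrix (Fin n) (Fin 1) S)
    (r : Matrix (Fin 1) (Fin n) S) (s : Matrix (Fin 1) (Fin 1) S)
    (hP : IsUnit P) (h1 : P * Pᴴ = 1 + (2 : S) • (q * qᴴ)) (h3 : r * Pᴴ = (2 : S) • (s * qᴴ))
    (hdet : (fromBlocks P q r s).det = 1) :
    s = star P.det • 1 ∧ r = (2 : S) • (star P.det • (qᴴ * (Pᴴ)⁻¹)) := by
  have hd : IsUnit P.det := (Matrix.isUnit_iff_isUnit_det P).1 hP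
  have hd' : IsUnit (Pᴴ).det := by rw [det_conjTranspose]; exact hd.star
  have hr : r = (2 : S) • (s 0 0 • (qᴴ * (Pᴴ)⁻¹)) := by
    have : r * Pᴴ * (Pᴴ)⁻¹ = r := Matrix.mul_nonsing_inv_cancel_right _ _ hd'
    rw [← this, h3, eq_smul_one_of_fin_one s]
    simp
  let _ := hP.invertible
  have hs := det_mul_star_det_mul_schur (G := (Pᴴ)⁻¹ * P⁻¹) h1 (by
    rw [Matrix.mul_assoc, ← Matrix.mul_assoc P⁻¹, Matrix.nonsing_inv_mul _ hd, Matrix.one_mul,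
      Matrix.nonsing_inv_mul _ hd'])
  rw [det_fromBlocks₁₁, Matrix.det_fin_one, invOf_eq_nonsing_inv, hr] at hdet
  simp only [Matrix.smul_mul, Matrix.sub_apply, Matrix.smul_apply, smul_eq_mul,
    Matrix.mul_assoc] at hdet hs
  set u := 1 - 2 * (qᴴ * ((Pᴴ)⁻¹ * (P⁻¹ * q))) 0 0 with hu
  have hss : s 0 0 = star P.det := by
    have e1 : P.det * u * s 0 0 = 1 := by rw [hu]; linear_combination hdet
    linear_combination (star P.det) * e1 - (s 0 0) * hs
  refine ⟨?_, by rw [hr, hss]⟩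
  rw [← hss]; exact eq_smul_one_of_fin_one s

lemma unitary_of_top (P : Matrix (Fin n) (Fin n) S) (q : Matrix (Fin n) (Fin 1) S)
    (hP : IsUnit P) (h1 : P * Pᴴ = 1 + (2 : S) • (q * qᴴ)) :
    let A := fromBlocks P q ((2 : S) • (star P.det • (qᴴ * (Pᴴ)⁻¹))) (star P.det • 1)
    A * blockForm S n * Aᴴ = blockForm S n ∧ A.det = 1 := by
  intro A
  have hd : IsUnit P.det := (Matrix.isUnit_iff_isUnit_det P).1 hP
  have hd' : IsUnit (Pᴴ).det := by rw [det_conjTranspose]; exact hd.star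
  have hs := det_mul_star_det_mul_schur (G := (Pᴴ)⁻¹ * P⁻¹) h1 (by
    rw [Matrix.mul_assoc, ← Matrix.mul_assoc P⁻¹, Matrix.nonsing_inv_mul _ hd, Matrix.one_mul,
      Matrix.nonsing_inv_mul _ hd'])
  have hPi : ((Pᴴ)⁻¹)ᴴ = P⁻¹ := by rw [conjTranspose_nonsing_inv, conjTranspose_conjTranspose]
  constructor
  · rw [blockForm_unitary_iff]
    refine ⟨h1, ?_, ?_, ?_⟩
    · simp [conjTranspose_smul, conjTranspose_mul, hPi, Matrix.mul_nonsing_inv_cancel_left _ _ hd]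
    · simp [Matrix.mul_assoc, Matrix.nonsing_inv_mul _ hd']
    · ext i j
      fin_cases i; fin_cases j
      simp only [conjTranspose_smul, conjTranspose_mul, conjTranspose_conjTranspose, hPi,
        Matrix.smul_mul, Matrix.mul_smul, star_star, star_ofNat, conjTranspose_one,
        Matrix.mul_one, Matrix.mul_assoc, Matrix.add_apply, Matrix.smul_apply, smul_eq_mul,
        Fin.zero_eta, Matrix.one_apply_eq] at hs ⊢
      linear_combination -2 * hs
  · let _ := hP.invertible
    rw [det_fromBlocks₁₁, Matrix.det_fin_one, invOf_eq_nonsing_inv]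
    simp only [Matrix.smul_mul, Matrix.sub_apply, Matrix.smul_apply, smul_eq_mul,
      Matrix.mul_assoc, Matrix.one_apply_eq] at hs ⊢
    linear_combination hs

lemma isUnit_of_mul_conjTranspose_eq (h8 : (8 : S) = 0) {P K : Matrix (Fin n) (Fin n) S}
    (h : P * Pᴴ = 1 + (2 : S) • K) : IsUnit P := by
  have := isUnit_one_add_two_smul h8 K
  rw [← h, Matrix.isUnit_iff_isUnit_det, det_mul] at this
  exact (Matrix.isUnit_iff_isUnit_det P).2 (isUnit_of_mul_isUnit_left this)

lemma card_special_unitary_eq (h8 : (8 : S) = 0) :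
    Nat.card {A : Matrix (Fin n ⊕ Fin 1) (Fin n ⊕ Fin 1) S //
        A * blockForm S n * Aᴴ = blockForm S n ∧ A.det = 1} =
      Nat.card (Σ q : Matrix (Fin n) (Fin 1) S,
        {P : Matrix (Fin n) (Fin n) S // P * Pᴴ = 1 + (2 : S) • (q * qᴴ)}) := by
  symm
  refine Nat.card_congr ⟨fun x => ⟨_, unitary_of_top x.2.1 x.1
      (isUnit_of_mul_conjTranspose_eq h8 x.2.2) x.2.2⟩,
    fun A => ⟨A.1.toBlocks₁₂, A.1.toBlocks₁₁, ?_⟩, ?_, ?_⟩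
  · have h := A.2.1
    rw [← fromBlocks_toBlocks A.1, blockForm_unitary_iff] at h
    exact h.1
  · rintro ⟨q, P, h⟩
    simp
  · rintro ⟨A, hA, hdet⟩
    obtain ⟨P, q, r, s, rfl⟩ : ∃ P q r s, A = fromBlocks P q r s :=
      ⟨_, _, _, _, (fromBlocks_toBlocks A).symm⟩
    have h := (blockForm_unitary_iff P q r s).1 hA
    obtain ⟨hs, hr⟩ := bottom_eq_of_unitary P q r s (isUnit_of_mul_conjTranspose_eq h8 h.1) h.1
      h.2.2.1 hdet
    apply Subtype.ext
    simp only [toBlocks_fromBlocks₁₁, toBlocks_fromBlocks₁₂]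
    rw [← hs, ← hr]

end Blocks

/-- The model `(ℤ/8)[ω]/(ω² - ω - c)` of `O/(8)`; its conjugation is `star`. -/
abbrev Qc (c : ZMod 8) : Type := QuadraticAlgebra (ZMod 8) c 1

namespace Qc

variable {c : ZMod 8}

instance : Fintype (Qc c) := Fintype.ofEquiv _ (QuadraticAlgebra.equivProd c 1).symm

instance : DecidableEq (Qc c) := (QuadraticAlgebra.equivProd c 1).decidableEq

lemma card_eq : Nat.card (Qc c) = 64 := by
  rw [Nat.card_congr (QuadraticAlgebra.equivProd c 1), Nat.card_prod, Nat.card_zmod]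

lemma eight_eq_zero : (8 : Qc c) = 0 := by
  ext <;> simp <;> rfl

lemma star_eq_self_iff {x : Qc c} : star x = x ↔ x.im = 0 := by
  rw [QuadraticAlgebra.ext_iff]
  simp only [QuadraticAlgebra.re_star, QuadraticAlgebra.im_star, one_mul, add_eq_left]
  exact ⟨fun h => h.1, fun h => by simp [h]⟩

/-- The sign character of `ℤ/8`, trivial on even elements. -/
def sgn (x : ZMod 8) : ℤ := (-1) ^ x.val

lemma sgn_add (x y : ZMod 8) : sgn (x + y) = sgn x * sgn y := by
  revert x y; decide

lemma sgn_zero : sgn 0 = 1 := rfl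

lemma sgn_two_mul (x : ZMod 8) : sgn (2 * x) = 1 := by
  revert x; decide

lemma sgn_sum {ι : Type*} (s : Finset ι) (f : ι → ZMod 8) :
    sgn (∑ i ∈ s, f i) = ∏ i ∈ s, sgn (f i) := by
  classical
  induction s using Finset.induction_on with
  | empty => simp [sgn_zero]
  | insert a s ha ih => rw [Finset.sum_insert ha, Finset.prod_insert ha, sgn_add, ih]

lemma re_sum {ι : Type*} (s : Finset ι) (f : ι → Qc c) :
    (∑ i ∈ s, f i).re = ∑ i ∈ s, (f i).re :=
  map_sum (QuadraticAlgebra.reₗ (R := ZMod 8) (a := c) (b := 1)) f s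

lemma sum_sgn_norm (c : ZMod 8) : ∑ a : Qc c, sgn (a * star a).re = 32 * sgn c := by
  rw [← (QuadraticAlgebra.equivProd c 1).symm.sum_comp, Fintype.sum_prod_type]
  simp only [QuadraticAlgebra.equivProd, Equiv.coe_fn_symm_mk, QuadraticAlgebra.re_mul,
    QuadraticAlgebra.re_star, QuadraticAlgebra.im_star]
  revert c
  decide +kernel

lemma exists_norm_eq (c t : ZMod 8) (ht : sgn t = -1) :
    ∃ a : Qc c, a * star a = ⟨t, 0⟩ := by
  have : ∀ c t : ZMod 8, sgn t = -1 → ∃ x y : ZMod 8,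
      x * (x + y) + c * y * (-y) = t := by decide +kernel
  obtain ⟨x, y, h⟩ := this c t ht
  refine ⟨⟨x, y⟩, ?_⟩
  ext
  · simpa using h
  · simp; ring

/-- The scalar `v vᴴ` of a row vector `v`. -/
def rowNorm {n : ℕ} (v : Matrix (Fin 1) (Fin n) (Qc c)) : ZMod 8 := ((v * vᴴ) 0 0).re

lemma mul_conjTranspose_eq_iff {n : ℕ} (v : Matrix (Fin 1) (Fin n) (Qc c))
    {h : Matrix (Fin 1) (Fin 1) (Qc c)} (hh : hᴴ = h) :
    v * vᴴ = h ↔ rowNorm v = (h 0 0).re := by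
  have him : ∀ X : Matrix (Fin 1) (Fin 1) (Qc c), Xᴴ = X → (X 0 0).im = 0 := fun X hX =>
    star_eq_self_iff.1 (by rw [← conjTranspose_apply, hX])
  refine ⟨fun e => by rw [rowNorm, e], fun e => ?_⟩
  ext i j : 2
  · fin_cases i; fin_cases j; exact e
  · fin_cases i; fin_cases j
    exact (him _ (by simp)).trans (him _ hh).symm

lemma sum_sgn_rowNorm (n : ℕ) :
    ∑ v : Matrix (Fin 1) (Fin n) (Qc c), sgn (rowNorm v) = (32 * sgn c) ^ n := by
  rw [← sum_sgn_norm, Fintype.sum_pow]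
  refine Fintype.sum_equiv (Equiv.funUnique (Fin 1) (Fin n → Qc c)) _ _
    fun (v : Matrix (Fin 1) (Fin n) (Qc c)) => ?_
  change sgn ((v * vᴴ) 0 0).re = _
  rw [Matrix.mul_apply, re_sum, sgn_sum]
  rfl

section Complement

variable {k n : ℕ} {P : Matrix (Fin k) (Fin n) (Qc c)} {H : Matrix (Fin k) (Fin k) (Qc c)}

/-- The row vectors orthogonal to the rows of `P`. -/
abbrev Orth (P : Matrix (Fin k) (Fin n) (Qc c)) : Type :=
  {w : Matrix (Fin 1) (Fin n) (Qc c) // w * Pᴴ = 0}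

/-- The orthogonal decomposition along the row space of `P` with invertible Gram matrix. -/
noncomputable def decomp (hP : P * Pᴴ = H) (hH : IsUnit H) :
    Matrix (Fin 1) (Fin k) (Qc c) × Orth P ≃ Matrix (Fin 1) (Fin n) (Qc c) where
  toFun x := x.1 * P + x.2.1
  invFun v := (v * Pᴴ * H⁻¹, ⟨v - v * Pᴴ * H⁻¹ * P, by
    rw [Matrix.sub_mul, Matrix.mul_assoc _ P, hP,
      Matrix.nonsing_inv_mul_cancel_right _ _ ((Matrix.isUnit_iff_isUnit_det H).1 hH), sub_self]⟩)
  left_inv := by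
    rintro ⟨x, w, hw⟩
    have : (x * P + w) * Pᴴ * H⁻¹ = x := by
      rw [Matrix.add_mul, hw, add_zero, Matrix.mul_assoc x, hP,
        Matrix.mul_nonsing_inv_cancel_right _ _ ((Matrix.isUnit_iff_isUnit_det H).1 hH)]
    ext1
    · exact this
    · ext1; simp [this]
  right_inv v := by simp

lemma decomp_gram (x : Matrix (Fin 1) (Fin k) (Qc c)) {w : Matrix (Fin 1) (Fin n) (Qc c)}
    (hP : P * Pᴴ = H) (hw : w * Pᴴ = 0) :
    (x * P + w) * (x * P + w)ᴴ = x * H * xᴴ + w * wᴴ := by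
  have hw' : P * wᴴ = 0 := by
    rw [← conjTranspose_inj, conjTranspose_mul, conjTranspose_conjTranspose, hw,
      conjTranspose_zero]
  rw [conjTranspose_add, conjTranspose_mul, Matrix.add_mul, Matrix.mul_add, Matrix.mul_add,
    ← Matrix.mul_assoc w, hw, Matrix.mul_assoc x P wᴴ, hw', Matrix.mul_assoc x P,
    ← Matrix.mul_assoc P, hP, Matrix.mul_assoc]
  simp

lemma two_smul_re (x : Qc c) : ((2 : Qc c) • x).re = 2 * x.re := by
  rw [two_smul, QuadraticAlgebra.re_add, two_mul]

lemma card_orth (hP : P * Pᴴ = H) (hH : IsUnit H) (hk : k ≤ n) :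
    (Nat.card (Orth P) : ℤ) = 64 ^ (n - k) := by
  have h := Nat.card_congr (decomp hP hH)
  have hc : ∀ m, Nat.card (Matrix (Fin 1) (Fin m) (Qc c)) = 64 ^ m := fun m => by
    rw [Matrix, Nat.card_fun, Nat.card_fun, card_eq]; simp
  rw [Nat.card_prod, hc, hc, ← pow_mul_pow_sub _ hk] at h
  have := Nat.eq_of_mul_eq_mul_left (by positivity) h
  rw [this]; simp

lemma sum_orth {K : Matrix (Fin k) (Fin k) (Qc c)} (hP : P * Pᴴ = 1 + (2 : Qc c) • K)
    (hk : k ≤ n) :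
    ∑ w : Orth P, sgn (rowNorm w.1) = (32 * sgn c) ^ (n - k) := by
  have h := (decomp hP (isUnit_one_add_two_smul eight_eq_zero K)).sum_comp
    (fun v => sgn (rowNorm v))
  have hs : sgn c ≠ 0 := pow_ne_zero _ (by norm_num)
  have key : ∀ x : Matrix (Fin 1) (Fin k) (Qc c) × Orth P,
      sgn (rowNorm (decomp hP (isUnit_one_add_two_smul eight_eq_zero K) x)) =
        sgn (rowNorm x.1) * sgn (rowNorm x.2.1) := by
    rintro ⟨x, w, hw⟩
    change sgn (rowNorm (x * P + w)) = _
    simp only [rowNorm, decomp_gram x hP hw, Matrix.mul_add, Matrix.add_mul, Matrix.mul_one,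
      Matrix.mul_smul, Matrix.smul_mul, Matrix.add_apply, Matrix.smul_apply,
      QuadraticAlgebra.re_add, sgn_add, two_smul_re, sgn_two_mul, mul_one]
  simp only [key] at h
  rw [Fintype.sum_prod_type] at h
  dsimp only at h
  rw [← Fintype.sum_mul_sum, sum_sgn_rowNorm, sum_sgn_rowNorm, ← pow_mul_pow_sub _ hk] at h
  exact mul_left_cancel₀ (pow_ne_zero _ (by positivity)) h

lemma rowNorm_smul {a : Qc c} {t : ZMod 8} (ha : a * star a = ⟨t, 0⟩)
    (w : Matrix (Fin 1) (Fin n) (Qc c)) : rowNorm (a • w) = t * rowNorm w := by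
  rw [rowNorm, conjTranspose_smul, Matrix.smul_mul, Matrix.mul_smul, smul_smul, ha]
  simp [rowNorm]

lemma card_orth_rowNorm_eq (P : Matrix (Fin k) (Fin n) (Qc c)) (t : ZMod 8) (ht : sgn t = -1) :
    Nat.card {w : Orth P // rowNorm w.1 = t} = Nat.card {w : Orth P // rowNorm w.1 = 1} := by
  obtain ⟨a, ha⟩ := exists_norm_eq c t ht
  have hu : t * t = 1 := by
    have : ∀ t : ZMod 8, sgn t = -1 → t * t = 1 := by decide
    exact this t ht
  have hu' : (⟨t, 0⟩ * ⟨t, 0⟩ : Qc c) = 1 := by ext <;> simp [hu, QuadraticAlgebra.re_one,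
    QuadraticAlgebra.im_one]
  have hst : star (⟨t, 0⟩ : Qc c) = ⟨t, 0⟩ := by simp
  set b : Qc c := star a * ⟨t, 0⟩ with hb
  have hab : a * b = 1 := by rw [hb, ← mul_assoc, ha, hu']
  have hbb : b * star b = ⟨t, 0⟩ := by
    rw [hb, star_mul, star_star, hst]
    linear_combination (⟨t, 0⟩ * ⟨t, 0⟩ : Qc c) * ha + (⟨t, 0⟩ : Qc c) * hu'
  refine Nat.card_congr
    ⟨fun w => ⟨⟨b • w.1.1, by rw [Matrix.smul_mul, w.1.2, smul_zero]⟩, ?_⟩,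
      fun w => ⟨⟨a • w.1.1, by rw [Matrix.smul_mul, w.1.2, smul_zero]⟩, ?_⟩, ?_, ?_⟩
  · rw [rowNorm_smul hbb, w.2, hu]
  · rw [rowNorm_smul ha, w.2, mul_one]
  · intro w
    ext1; ext1
    simp only [smul_smul, hab, one_smul]
  · intro w
    ext1; ext1
    simp only [smul_smul, mul_comm b, hab, one_smul]

lemma eight_mul_card_orth {K : Matrix (Fin k) (Fin k) (Qc c)} (hP : P * Pᴴ = 1 + (2 : Qc c) • K)
    (hk : k ≤ n) (t : ZMod 8) (ht : sgn t = -1) :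
    8 * (Nat.card {w : Orth P // rowNorm w.1 = t} : ℤ) =
      64 ^ (n - k) - (32 * sgn c) ^ (n - k) := by
  rw [← card_orth hP (isUnit_one_add_two_smul eight_eq_zero K) hk, ← sum_orth hP hk]
  have h1 : ∀ g : ZMod 8 → ℤ, ∑ w : Orth P, g (rowNorm w.1) =
      ∑ t, (Nat.card {w : Orth P // rowNorm w.1 = t} : ℤ) * g t := fun g => by
    rw [← Finset.sum_fiberwise (s := Finset.univ) (g := fun w : Orth P => rowNorm w.1)]
    refine Finset.sum_congr rfl fun t _ => ?_
    rw [Finset.sum_congr rfl (g := fun _ => g t) (fun w hw => by rw [(Finset.mem_filter.1 hw).2]),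
      Finset.sum_const, Nat.card_eq_fintype_card, Fintype.card_subtype, nsmul_eq_mul]
  have h2 : (Nat.card (Orth P) : ℤ) = ∑ w : Orth P, 1 := by simp
  rw [h2, h1 (fun _ => 1), h1 sgn, card_orth_rowNorm_eq P t ht]
  have h3 := card_orth_rowNorm_eq P 3 rfl
  have h5 := card_orth_rowNorm_eq P 5 rfl
  have h7 := card_orth_rowNorm_eq P 7 rfl
  have hsum : ∀ g : ZMod 8 → ℤ, ∑ t, g t = g 0 + g 1 + g 2 + g 3 + g 4 + g 5 + g 6 + g 7 :=
    fun g => Fin.sum_univ_eight g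
  rw [hsum, hsum, h3, h5, h7, show sgn 0 = 1 from rfl, show sgn 1 = -1 from rfl,
    show sgn 2 = 1 from rfl, show sgn 3 = -1 from rfl, show sgn 4 = 1 from rfl,
    show sgn 5 = -1 from rfl, show sgn 6 = 1 from rfl, show sgn 7 = -1 from rfl]
  ring

lemma card_fiber {K : Matrix (Fin k) (Fin k) (Qc c)} (hP : P * Pᴴ = 1 + (2 : Qc c) • K)
    (hk : k ≤ n) (h : Matrix (Fin 1) (Fin k) (Qc c)) {η e : Matrix (Fin 1) (Fin 1) (Qc c)}
    (hη : ηᴴ = η) (he : η = 1 + (2 : Qc c) • e) :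
    8 * (Nat.card {w : Matrix (Fin 1) (Fin n) (Qc c) //
        w * Pᴴ = (2 : Qc c) • h ∧ w * wᴴ = η} : ℤ) =
      64 ^ (n - k) - (32 * sgn c) ^ (n - k) := by
  set H := 1 + (2 : Qc c) • K with hHdef
  have hH : IsUnit H.det :=
    (Matrix.isUnit_iff_isUnit_det H).1 (isUnit_one_add_two_smul eight_eq_zero K)
  set x := (2 : Qc c) • (h * H⁻¹) with hx
  have hxP : x * P * Pᴴ = (2 : Qc c) • h := by
    rw [Matrix.mul_assoc, hP, hx, Matrix.smul_mul, Matrix.nonsing_inv_mul_cancel_right _ _ hH]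
  have hHH : Hᴴ = H := by rw [← hP, conjTranspose_mul, conjTranspose_conjTranspose]
  have hη' : (η - x * H * xᴴ)ᴴ = η - x * H * xᴴ := by
    rw [conjTranspose_sub, hη, conjTranspose_mul, conjTranspose_mul, conjTranspose_conjTranspose,
      hHH, Matrix.mul_assoc]
  rw [← eight_mul_card_orth hP hk ((η - x * H * xᴴ) 0 0).re]
  · congr 2
    refine Nat.card_congr ⟨fun w => ⟨⟨w.1 - x * P, ?_⟩, ?_⟩, fun w => ⟨x * P + w.1.1, ?_, ?_⟩,
      ?_, ?_⟩
    · rw [Matrix.sub_mul, w.2.1, hxP, sub_self]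
    · have h0 : (w.1 - x * P) * Pᴴ = 0 := by rw [Matrix.sub_mul, w.2.1, hxP, sub_self]
      have h1 := decomp_gram x hP h0
      rw [add_sub_cancel, w.2.2] at h1
      exact (mul_conjTranspose_eq_iff _ hη').1 (eq_sub_iff_add_eq'.2 h1.symm)
    · rw [Matrix.add_mul, w.1.2, hxP, add_zero]
    · rw [decomp_gram x hP w.1.2, (mul_conjTranspose_eq_iff _ hη').2 w.2]; simp
    · intro w; simp
    · intro w
      ext1; ext1
      exact add_sub_cancel_left _ _
  · have hdecomp : η - x * H * xᴴ = 1 + (2 : Qc c) • (e - h * H⁻¹ * H * xᴴ) := by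
      rw [he, smul_sub, add_sub_assoc, hx]
      simp
    rw [hdecomp, Matrix.add_apply, Matrix.smul_apply, QuadraticAlgebra.re_add, two_smul_re,
      sgn_add, sgn_two_mul]
    rfl

end Complement

lemma gram_eq_iff {k n : ℕ} (P : Matrix (Fin (k + 1)) (Fin n) (Qc c))
    {H : Matrix (Fin (k + 1)) (Fin (k + 1)) (Qc c)} (hH : Hᴴ = H) :
    P * Pᴴ = H ↔
      P.submatrix Fin.castSucc id * (P.submatrix Fin.castSucc id)ᴴ =
        H.submatrix Fin.castSucc Fin.castSucc ∧
      P.submatrix (fun _ : Fin 1 => Fin.last k) id * (P.submatrix Fin.castSucc id)ᴴ =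
        H.submatrix (fun _ => Fin.last k) Fin.castSucc ∧
      P.submatrix (fun _ : Fin 1 => Fin.last k) id *
        (P.submatrix (fun _ : Fin 1 => Fin.last k) id)ᴴ =
        H.submatrix (fun _ => Fin.last k) (fun _ => Fin.last k) := by
  constructor
  · rintro rfl
    exact ⟨rfl, rfl, rfl⟩
  · rintro ⟨h1, h2, h3⟩
    have h12 : ∀ i : Fin k, (P * Pᴴ) (Fin.last k) i.castSucc = H (Fin.last k) i.castSucc :=
      fun i => congrFun (congrFun h2 0) i
    ext1 i j
    induction i using Fin.lastCases with
    | last =>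
      induction j using Fin.lastCases with
      | last => exact congrFun (congrFun h3 0) 0
      | cast j => exact h12 j
    | cast i =>
      induction j using Fin.lastCases with
      | last =>
        have hPP : (P * Pᴴ)ᴴ = P * Pᴴ := by rw [conjTranspose_mul, conjTranspose_conjTranspose]
        rw [← hPP, ← hH, conjTranspose_apply, conjTranspose_apply, h12]
      | cast j => exact congrFun (congrFun h1 i) j

/-- Appending a last row to a matrix. -/
def snocRow {k n : ℕ} (P : Matrix (Fin k) (Fin n) (Qc c)) (w : Matrix (Fin 1) (Fin n) (Qc c)) :
    Matrix (Fin (k + 1)) (Fin n) (Qc c) :=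
  Matrix.of fun i j => Fin.snoc (α := fun _ => Qc c) (fun i => P i j) (w 0 j) i

lemma snocRow_submatrix_castSucc {k n : ℕ} (P : Matrix (Fin k) (Fin n) (Qc c))
    (w : Matrix (Fin 1) (Fin n) (Qc c)) : (snocRow P w).submatrix Fin.castSucc id = P := by
  ext1 i j
  simp [snocRow]

lemma snocRow_submatrix_last {k n : ℕ} (P : Matrix (Fin k) (Fin n) (Qc c))
    (w : Matrix (Fin 1) (Fin n) (Qc c)) :
    (snocRow P w).submatrix (fun _ : Fin 1 => Fin.last k) id = w := by
  ext1 i j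
  fin_cases i
  simp [snocRow]

/-- Splitting off the last row of a matrix with prescribed Gram matrix. -/
def splitLastRow {k n : ℕ} {H : Matrix (Fin (k + 1)) (Fin (k + 1)) (Qc c)} (hH : Hᴴ = H) :
    {P : Matrix (Fin (k + 1)) (Fin n) (Qc c) // P * Pᴴ = H} ≃
      Σ P : {P : Matrix (Fin k) (Fin n) (Qc c) //
          P * Pᴴ = H.submatrix Fin.castSucc Fin.castSucc},
        {w : Matrix (Fin 1) (Fin n) (Qc c) //
          w * P.1ᴴ = H.submatrix (fun _ => Fin.last k) Fin.castSucc ∧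
          w * wᴴ = H.submatrix (fun _ => Fin.last k) (fun _ => Fin.last k)} where
  toFun P := ⟨⟨P.1.submatrix Fin.castSucc id, ((gram_eq_iff P.1 hH).1 P.2).1⟩,
    ⟨P.1.submatrix (fun _ => Fin.last k) id, ((gram_eq_iff P.1 hH).1 P.2).2⟩⟩
  invFun x := ⟨snocRow x.1.1 x.2.1, by
    rw [gram_eq_iff _ hH, snocRow_submatrix_castSucc, snocRow_submatrix_last]
    exact ⟨x.1.2, x.2.2⟩⟩
  left_inv P := by
    ext1; ext1 i j
    induction i using Fin.lastCases <;> simp [snocRow]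
  right_inv x := Sigma.subtype_ext (Subtype.ext (snocRow_submatrix_castSucc _ _))
    (snocRow_submatrix_last _ _)

lemma card_gram {k n : ℕ} (hk : k ≤ n) {H K : Matrix (Fin k) (Fin k) (Qc c)} (hH : Hᴴ = H)
    (hK : H = 1 + (2 : Qc c) • K) :
    8 ^ k * (Nat.card {P : Matrix (Fin k) (Fin n) (Qc c) // P * Pᴴ = H} : ℤ) =
      ∏ i ∈ Finset.range k, (64 ^ (n - i) - (32 * sgn c) ^ (n - i)) := by
  induction k with
  | zero =>
    have : Unique {P : Matrix (Fin 0) (Fin n) (Qc c) // P * Pᴴ = H} :=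
      ⟨⟨⟨0, Subsingleton.elim _ _⟩⟩, fun _ => Subsingleton.elim _ _⟩
    rw [Nat.card_unique]
    simp
  | succ k ih =>
    have hH' : (H.submatrix Fin.castSucc Fin.castSucc)ᴴ =
        H.submatrix Fin.castSucc Fin.castSucc := by rw [conjTranspose_submatrix, hH]
    have hK' : H.submatrix Fin.castSucc Fin.castSucc =
        1 + (2 : Qc c) • K.submatrix Fin.castSucc Fin.castSucc := by
      rw [hK, submatrix_add, submatrix_smul, Pi.add_apply, Pi.add_apply,
        submatrix_one _ (Fin.castSucc_injective k)]
      rfl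
    rw [Nat.card_congr (splitLastRow hH), Nat.card_sigma, Finset.prod_range_succ,
      ← ih (by omega) hH' hK']
    push_cast
    rw [pow_succ, mul_assoc, Finset.mul_sum]
    rw [Finset.sum_congr rfl (g := fun _ => (64 ^ (n - k) - (32 * sgn c) ^ (n - k) : ℤ))]
    · simp
      ring
    · rintro ⟨P, hP⟩ -
      rw [hK'] at hP
      have h2 : H.submatrix (fun _ : Fin 1 => Fin.last k) Fin.castSucc =
          (2 : Qc c) • K.submatrix (fun _ : Fin 1 => Fin.last k) Fin.castSucc := by
        rw [hK]
        ext1 i j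
        simp [(Fin.castSucc_lt_last j).ne']
      have h3 : H.submatrix (fun _ : Fin 1 => Fin.last k) (fun _ : Fin 1 => Fin.last k) =
          1 + (2 : Qc c) • K.submatrix (fun _ : Fin 1 => Fin.last k)
            (fun _ : Fin 1 => Fin.last k) := by
        rw [hK]
        ext1 i j
        fin_cases i; fin_cases j
        simp
      have h4 : (H.submatrix (fun _ : Fin 1 => Fin.last k) (fun _ : Fin 1 => Fin.last k))ᴴ =
          H.submatrix (fun _ : Fin 1 => Fin.last k) (fun _ : Fin 1 => Fin.last k) := by
        rw [conjTranspose_submatrix, hH]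
      rw [h2]
      exact card_fiber hP (by omega) _ h4 h3

end Qc

section Transport

/-- The image of `ω` in the model `(ℤ/8)[ω]`. -/
def modelParam (d : ℤ) : ZMod 8 := -(((1 + d) / 4 : ℤ) : ZMod 8)

lemma sgn_modelParam {d : ℤ} (hd4 : d % 4 = 3) :
    Qc.sgn (modelParam d) = ZMod.χ₈ ((-d : ℤ) : ZMod 8) := by
  obtain ⟨m, hm⟩ : ∃ m, 1 + d = 4 * m := ⟨(1 + d) / 4, by omega⟩
  have h1 : modelParam d = -(m : ZMod 8) := by
    rw [modelParam, hm, Int.mul_ediv_cancel_left _ (by norm_num)]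
  have h2 : ((-d : ℤ) : ZMod 8) = 1 + 4 * -(m : ZMod 8) := by
    rw [show -d = 1 + 4 * -m by omega]; push_cast; ring
  rw [h1, h2]
  have : ∀ x : ZMod 8, Qc.sgn x = ZMod.χ₈ (1 + 4 * x) := by decide
  exact this _

/-- The generator `ω` of `O`. -/
noncomputable abbrev rootOg (d : ℤ) : Og d := AdjoinRoot.root _

/-- Reduction of `O` to the model `(ℤ/8)[ω]`. -/
noncomputable def redOg (d : ℤ) : Og d →+* Qc (modelParam d) :=
  AdjoinRoot.lift (Int.castRingHom _) QuadraticAlgebra.omega (by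
    simp only [Polynomial.eval₂_add, Polynomial.eval₂_sub, Polynomial.eval₂_pow,
      Polynomial.eval₂_X, Polynomial.eval₂_C]
    rw [pow_two, eq_intCast]
    ext
    · simp
      simp [modelParam]
    · simp)

lemma redOg_root (d : ℤ) : redOg d (rootOg d) = QuadraticAlgebra.omega :=
  AdjoinRoot.lift_root _

lemma exists_eq_add_mul_root (d : ℤ) (x : Og d) :
    ∃ a b : ℤ, x = a + b * rootOg d := by
  have hroot : rootOg d ^ 2 = rootOg d - ((1 + d) / 4 : ℤ) := by
    have h := AdjoinRoot.eval₂_root (X ^ 2 - X + C ((1 + d) / 4) : ℤ[X])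
    simp only [Polynomial.eval₂_add, Polynomial.eval₂_sub, Polynomial.eval₂_pow,
      Polynomial.eval₂_X, Polynomial.eval₂_C] at h
    rw [eq_intCast (AdjoinRoot.of _)] at h
    linear_combination h
  induction x using AdjoinRoot.induction_on with
  | ih p =>
    induction p using Polynomial.induction_on with
    | C a => exact ⟨a, 0, by simp⟩
    | add p q hp hq =>
      obtain ⟨a, b, h⟩ := hp
      obtain ⟨a', b', h'⟩ := hq
      exact ⟨a + a', b + b', by rw [map_add, h, h']; push_cast; ring⟩
    | monomial n a h =>
      obtain ⟨a', b', h⟩ := h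
      refine ⟨-b' * ((1 + d) / 4), a' + b', ?_⟩
      rw [show C a * X ^ (n + 1) = C a * X ^ n * X by ring, map_mul, h, AdjoinRoot.mk_X]
      push_cast
      linear_combination (b' : Og d) * hroot

lemma redOg_apply (d a b : ℤ) : redOg d (a + b * rootOg d) = ⟨a, b⟩ := by
  rw [map_add, map_mul, map_intCast, map_intCast, redOg_root]
  ext <;> simp

lemma redOg_conjOg (d : ℤ) (x : Og d) : redOg d (conjOg d x) = star (redOg d x) := by
  obtain ⟨a, b, rfl⟩ := exists_eq_add_mul_root d x
  rw [redOg_apply, map_add, map_mul, map_intCast, map_intCast, conjOg, AdjoinRoot.lift_root,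
    show (a : Og d) + b * (1 - rootOg d) = ((a + b : ℤ) : Og d) +
      ((-b : ℤ) : Og d) * rootOg d by push_cast; ring, redOg_apply]
  ext <;> simp

lemma redOg_eq_zero_iff (d : ℤ) (x : Og d) :
    redOg d x = 0 ↔ x ∈ Ideal.span {((8 : ℤ) : Og d)} := by
  rw [Ideal.mem_span_singleton]
  constructor
  · obtain ⟨a, b, rfl⟩ := exists_eq_add_mul_root d x
    rw [redOg_apply, QuadraticAlgebra.ext_iff]
    rintro ⟨ha, hb⟩
    obtain ⟨a, rfl⟩ := (ZMod.intCast_zmod_eq_zero_iff_dvd a 8).1 ha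
    obtain ⟨b, rfl⟩ := (ZMod.intCast_zmod_eq_zero_iff_dvd b 8).1 hb
    exact ⟨a + b * rootOg d, by push_cast; ring⟩
  · rintro ⟨y, rfl⟩
    rw [map_mul, map_intCast, Int.cast_ofNat, Qc.eight_eq_zero, zero_mul]

/-- The identification of `O/(8)` with its model. -/
noncomputable def redROg (d : ℤ) : ROg d 8 ≃+* Qc (modelParam d) :=
  RingEquiv.ofBijective (Ideal.Quotient.lift _ (redOg d) fun x hx => (redOg_eq_zero_iff d x).2 hx)
    ⟨by
      rw [injective_iff_map_eq_zero]
      intro x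
      obtain ⟨x, rfl⟩ := Ideal.Quotient.mk_surjective x
      rw [Ideal.Quotient.lift_mk, redOg_eq_zero_iff, Ideal.Quotient.eq_zero_iff_mem]
      exact id,
    fun y => ⟨Ideal.Quotient.mk _ ((y.re.cast : ℤ) + (y.im.cast : ℤ) * rootOg d), by
      rw [Ideal.Quotient.lift_mk, redOg_apply, ZMod.intCast_zmod_cast, ZMod.intCast_zmod_cast]⟩⟩

lemma redROg_conjROg (d : ℤ) (x : ROg d 8) :
    redROg d (conjROg d 8 x) = star (redROg d x) := by
  obtain ⟨x, rfl⟩ := Ideal.Quotient.mk_surjective x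
  exact redOg_conjOg d x

lemma map_submatrix_Mmat (d : ℤ) (n : ℕ) :
    ((Mmat (ROg d 8) n).map (redROg d)).submatrix finSumFinEquiv finSumFinEquiv =
      blockForm (Qc (modelParam d)) n := by
  rw [Mmat, diagonal_map (map_zero _), submatrix_diagonal_equiv, blockForm, smul_one_eq_diagonal,
    ← diagonal_one, fromBlocks_diagonal]
  congr 1
  ext1 i
  rcases i with i | i
  · simp [Fin.ext_iff, i.2.ne]
  · fin_cases i
    simp [Fin.ext_iff, map_ofNat]

lemma card_SU_eq_model (d : ℤ) (n : ℕ) :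
    Nat.card {A : Matrix (Fin (n + 1)) (Fin (n + 1)) (ROg d 8) //
        A * Mmat (ROg d 8) n * (A.map (conjROg d 8))ᵀ = Mmat (ROg d 8) n ∧ A.det = 1} =
      Nat.card {A : Matrix (Fin n ⊕ Fin 1) (Fin n ⊕ Fin 1) (Qc (modelParam d)) //
        A * blockForm _ n * Aᴴ = blockForm _ n ∧ A.det = 1} := by
  let F : Matrix (Fin (n + 1)) (Fin (n + 1)) (ROg d 8) ≃
      Matrix (Fin n ⊕ Fin 1) (Fin n ⊕ Fin 1) (Qc (modelParam d)) :=
    (redROg d).toEquiv.mapMatrix.trans (reindex finSumFinEquiv.symm finSumFinEquiv.symm)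
  have hF : ∀ A, F A = (A.map (redROg d)).submatrix finSumFinEquiv finSumFinEquiv := fun A => rfl
  have hmul : ∀ A B, F (A * B) = F A * F B := fun A B => by
    rw [hF, Matrix.map_mul, hF, hF, submatrix_mul_equiv]
  have hconj : ∀ A, F (A.map (conjROg d 8))ᵀ = (F A)ᴴ := fun A => by
    ext1 i j
    exact redROg_conjROg d _
  refine Nat.card_congr (F.subtypeEquiv fun A => and_congr ?_ ?_)
  · rw [← map_submatrix_Mmat, ← hF, ← hconj, ← hmul, ← hmul, F.injective.eq_iff]
  · rw [hF, det_submatrix_equiv_self, ← RingEquiv.mapMatrix_apply, ← RingEquiv.map_det,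
      map_eq_one_iff _ (redROg d).injective]

end Transport

lemma prod_sixty_four_pow_sub (n : ℕ) (s : ℚ) :
    8 ^ n * ∏ i ∈ Finset.range n, ((64 : ℚ) ^ (n - i) - (32 * s) ^ (n - i)) =
      2 ^ (3 * (n + 1) ^ 2 - 3) * ∏ i ∈ Finset.Icc 1 n, (1 - s ^ i * (2 : ℚ) ^ (-(i : ℤ))) := by
  have h1 : ∏ i ∈ Finset.range n, ((64 : ℚ) ^ (n - i) - (32 * s) ^ (n - i)) =
      ∏ i ∈ Finset.range n, ((64 : ℚ) ^ (i + 1) - (32 * s) ^ (i + 1)) := by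
    rw [← Finset.prod_range_reflect]
    refine Finset.prod_congr rfl fun i hi => ?_
    have := Finset.mem_range.1 hi
    rw [show n - (n - 1 - i) = i + 1 by omega]
  rw [h1, show 3 * (n + 1) ^ 2 - 3 = 3 * n ^ 2 + 6 * n by
    rw [show 3 * (n + 1) ^ 2 = 3 * n ^ 2 + 6 * n + 3 by ring, Nat.add_sub_cancel]]
  clear h1
  induction n with
  | zero => simp
  | succ n ih =>
    rw [Finset.prod_range_succ, Finset.prod_Icc_succ_top (by omega),
      show 3 * (n + 1) ^ 2 + 6 * (n + 1) = 3 * n ^ 2 + 6 * n + (3 + 6 * (n + 1)) by ring,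
      pow_add, mul_mul_mul_comm, pow_add _ (3 * n ^ 2 + 6 * n), mul_mul_mul_comm (2 ^ _), ← ih, pow_add _ 3, pow_mul _ 6, _root_.zpow_neg,
      zpow_natCast, mul_pow 32 s]
    have : (64 : ℚ) ^ (n + 1) * ((2 : ℚ) ^ (n + 1))⁻¹ = 32 ^ (n + 1) := by
      rw [← inv_pow, ← mul_pow]; norm_num
    rw [← this, show (2 : ℚ) ^ 6 = 64 by norm_num]
    ring

/-- For `d ≡ 3 (mod 4)`, the order of `SU(M, O/(8))` equals
`2^{3(n+1)²-3} · ∏_{i=1}^{n} (1 - χ₈(-d)^i · 2^{-i})`. -/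
theorem card_SU_M_mod_eight_unramified (d : ℤ) (hd : 0 < d) (hsf : Squarefree d)
    (hd4 : d % 4 = 3) (n : ℕ) (hn : 1 ≤ n) :
    (Nat.card {A : Matrix (Fin (n + 1)) (Fin (n + 1)) (ROg d 8) //
        A * Mmat (ROg d 8) n * (A.map (conjROg d 8))ᵀ = Mmat (ROg d 8) n ∧
        A.det = 1} : ℚ)
      = 2 ^ (3 * (n + 1) ^ 2 - 3) *
        ∏ i ∈ Finset.Icc 1 n,
          (1 - (ZMod.χ₈ ((-d : ℤ) : ZMod 8) : ℚ) ^ i * (2 : ℚ) ^ (-(i : ℤ))) := by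
  have h8 := Qc.eight_eq_zero (c := modelParam d)
  have hfib : ∀ q : Matrix (Fin n) (Fin 1) (Qc (modelParam d)),
      8 ^ n * (Nat.card {P : Matrix (Fin n) (Fin n) (Qc (modelParam d)) //
          P * Pᴴ = 1 + (2 : Qc (modelParam d)) • (q * qᴴ)} : ℤ) =
        ∏ i ∈ Finset.range n, (64 ^ (n - i) - (32 * Qc.sgn (modelParam d)) ^ (n - i)) := fun q =>
    Qc.card_gram le_rfl (by
      rw [conjTranspose_add, star_two_smul, conjTranspose_mul, conjTranspose_conjTranspose,
        conjTranspose_one]) rfl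
  rw [← prod_sixty_four_pow_sub, card_SU_eq_model, card_special_unitary_eq h8, Nat.card_sigma,
    ← sgn_modelParam hd4]
  have hcard : Fintype.card (Matrix (Fin n) (Fin 1) (Qc (modelParam d))) = 64 ^ n := by
    rw [← Nat.card_eq_fintype_card, Matrix, Nat.card_fun, Nat.card_fun, Qc.card_eq]; simp
  apply mul_left_cancel₀ (pow_ne_zero n (by norm_num : (8 : ℚ) ≠ 0))
  have hsum : 8 ^ n * ((∑ q : Matrix (Fin n) (Fin 1) (Qc (modelParam d)),
      Nat.card {P : Matrix (Fin n) (Fin n) (Qc (modelParam d)) //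
          P * Pᴴ = 1 + (2 : Qc (modelParam d)) • (q * qᴴ)} : ℕ) : ℤ) =
      64 ^ n * ∏ i ∈ Finset.range n,
        (64 ^ (n - i) - (32 * Qc.sgn (modelParam d)) ^ (n - i)) := by
    push_cast
    rw [Finset.mul_sum, Finset.sum_congr rfl fun q _ => hfib q, Finset.sum_const,
      Finset.card_univ, hcard, nsmul_eq_mul]
    push_cast
    rfl
  rw [← mul_assoc, ← mul_pow]
  rw [show (8 : ℚ) * 8 = 64 by norm_num]
  exact_mod_cast hsum
end

section
/- Let d be a positive squarefree integer with d ≡ 1 (mod 4) and n ≥ 1. Let R = ℤ[√-d]/(32) with σ the ring endomorphism induced by conjugation, and let M = diag(1,…,1,-2) of size n+1. Then the number N of matrices A ∈ M_{n+1}(R) with A·M·σ(A)ᵀ = M and det A = 1 satisfies, as rational numbers, N = 2^{5(n+1)²-5} · ∏_{i=1}^{⌊(n-1)/2⌋} (1 - 2^{-2i}). -/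
open Matrix

/-- The quotient ring `ℤ[√-d]/(m)`. -/
abbrev Rq (d m : ℤ) : Type := Zsqrtd (-d) ⧸ Ideal.span {(m : Zsqrtd (-d))}

/-- Conjugation `a + b√-d ↦ a - b√-d` descends to the quotient `ℤ[√-d]/(m)`. -/
noncomputable def conjQ (d m : ℤ) : Rq d m →+* Rq d m :=
  Ideal.quotientMap (Ideal.span {(m : Zsqrtd (-d))}) (starRingEnd (Zsqrtd (-d)))
    (by
      rw [Ideal.span_singleton_le_iff_mem, Ideal.mem_comap, map_intCast]
      exact Ideal.mem_span_singleton_self _)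

/-! ### The hermitian form `x ↦ x · M · x*` and the group `SU(M)` over a ring with involution -/

section Form

variable {R : Type*} [CommRing R] [StarRing R] {n : ℕ}

/-- The diagonal entries of `Mmat`. -/
def diagCoeff (R : Type*) [Ring R] (n : ℕ) (i : Fin (n + 1)) : R :=
  if i = Fin.last n then -2 else 1

/-- The sesquilinear form with Gram matrix `Mmat R n`. -/
def hform (x y : Fin (n + 1) → R) : R :=
  ∑ i, x i * diagCoeff R n i * star (y i)

/-- Matrices preserving `hform` (acting on row vectors). -/
def IsUnitaryM (A : Matrix (Fin (n + 1)) (Fin (n + 1)) R) : Prop :=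
  A * Mmat R n * Aᴴ = Mmat R n

theorem mul_Mmat_mul_conjTranspose_apply (A : Matrix (Fin (n + 1)) (Fin (n + 1)) R)
    (i j : Fin (n + 1)) : (A * Mmat R n * Aᴴ) i j = hform (A i) (A j) := by
  simp [Matrix.mul_apply, Mmat, hform, diagCoeff, Matrix.diagonal_apply]

theorem isUnitaryM_iff {A : Matrix (Fin (n + 1)) (Fin (n + 1)) R} :
    IsUnitaryM A ↔ ∀ i j, hform (A i) (A j) = if i = j then diagCoeff R n i else 0 := by
  rw [IsUnitaryM, ← Matrix.ext_iff]
  refine forall₂_congr fun i j => ?_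
  rw [mul_Mmat_mul_conjTranspose_apply, Mmat, Matrix.diagonal_apply]
  rfl

theorem star_diagCoeff (i : Fin (n + 1)) : star (diagCoeff R n i) = diagCoeff R n i := by
  unfold diagCoeff
  split_ifs <;> simp

theorem star_hform (x y : Fin (n + 1) → R) : star (hform x y) = hform y x := by
  simp only [hform, star_sum, star_mul', star_star, star_diagCoeff]
  exact Finset.sum_congr rfl fun i _ => by ring

theorem hform_sub_smul_sub_smul (x y u : Fin (n + 1) → R) (a b : R) :
    hform (x - a • u) (y - b • u) =
      hform x y - star b * hform x u - a * hform u y + a * star b * hform u u := by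
  simp only [hform, Finset.mul_sum, ← Finset.sum_sub_distrib, ← Finset.sum_add_distrib]
  refine Finset.sum_congr rfl fun i _ => ?_
  simp only [Pi.sub_apply, Pi.smul_apply, smul_eq_mul, star_sub, star_mul']
  ring

theorem hform_single_right (x : Fin (n + 1) → R) (i : Fin (n + 1)) :
    hform x (Pi.single i 1) = x i * diagCoeff R n i := by
  rw [hform, Finset.sum_eq_single i]
  · simp
  · intro j _ hj
    simp [hj]
  · simp

theorem hform_single_left (x : Fin (n + 1) → R) (i : Fin (n + 1)) :
    hform (Pi.single i 1) x = diagCoeff R n i * star (x i) := by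
  rw [← star_hform, hform_single_right, star_mul', star_diagCoeff, mul_comm]

theorem hform_vecCons (a b : R) (x y : Fin (n + 1) → R) :
    hform (n := n + 1) (Fin.cons a x : Fin (n + 2) → R) (Fin.cons b y : Fin (n + 2) → R) =
      a * star b + hform x y := by
  have h0 : (0 : Fin (n + 2)) ≠ Fin.last (n + 1) := (Fin.last_pos).ne
  have hs (i : Fin (n + 1)) : diagCoeff R (n + 1) i.succ = diagCoeff R n i := by
    simp only [diagCoeff, ← Fin.succ_last, Fin.succ_inj]
  rw [hform, Fin.sum_univ_succ]
  simp only [Fin.cons_zero, Fin.cons_succ, hs, hform]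
  simp [diagCoeff, h0]

namespace IsUnitaryM

variable {A B : Matrix (Fin (n + 1)) (Fin (n + 1)) R}

theorem mul (hA : IsUnitaryM A) (hB : IsUnitaryM B) : IsUnitaryM (A * B) := by
  unfold IsUnitaryM at *
  rw [Matrix.conjTranspose_mul]
  calc A * B * Mmat R n * (Bᴴ * Aᴴ) = A * (B * Mmat R n * Bᴴ) * Aᴴ := by
        simp only [Matrix.mul_assoc]
    _ = Mmat R n := by rw [hB, hA]

theorem inv (hA : IsUnitaryM A) (hdet : IsUnit A.det) : IsUnitaryM A⁻¹ := by
  unfold IsUnitaryM at *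
  have h : Aᴴ * (A⁻¹)ᴴ = 1 := by
    rw [← Matrix.conjTranspose_mul, Matrix.nonsing_inv_mul _ hdet, Matrix.conjTranspose_one]
  calc A⁻¹ * Mmat R n * (A⁻¹)ᴴ = A⁻¹ * (A * Mmat R n * Aᴴ) * (A⁻¹)ᴴ := by rw [hA]
    _ = (A⁻¹ * A) * Mmat R n * (Aᴴ * (A⁻¹)ᴴ) := by simp only [Matrix.mul_assoc]
    _ = Mmat R n := by rw [h, Matrix.nonsing_inv_mul _ hdet, Matrix.one_mul, Matrix.mul_one]

end IsUnitaryM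

end Form

/-! ### Quasi-reflections and transitivity on unit vectors -/

section Transitivity

variable {R : Type*} [CommRing R] [StarRing R] {n : ℕ}

/-- The quasi-reflection `x ↦ x - ω h(x, u) u`, acting on row vectors. -/
def quasiReflection (ω : R) (u : Fin (n + 1) → R) : Matrix (Fin (n + 1)) (Fin (n + 1)) R :=
  Matrix.of fun i => Pi.single i 1 - (ω * hform (Pi.single i 1) u) • u

theorem vecMul_quasiReflection (ω : R) (x u : Fin (n + 1) → R) :
    x ᵥ* quasiReflection ω u = x - (ω * hform x u) • u := by
  ext j
  simp only [Matrix.vecMul, dotProduct, quasiReflection, Matrix.of_apply, Pi.sub_apply,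
    Pi.smul_apply, smul_eq_mul, mul_sub, Finset.sum_sub_distrib, hform_single_left]
  congr 1
  · simp [Pi.single_apply]
  · rw [hform, Finset.mul_sum, Finset.sum_mul]
    exact Finset.sum_congr rfl fun i _ => by ring

theorem isUnitaryM_quasiReflection {ω : R} {u : Fin (n + 1) → R}
    (h : ω + star ω = ω * star ω * hform u u) : IsUnitaryM (quasiReflection ω u) := by
  rw [isUnitaryM_iff]
  intro i j
  have hij : hform (Pi.single i 1 : Fin (n + 1) → R) (Pi.single j 1) =
      if i = j then diagCoeff R n i else 0 := by
    rw [hform_single_right]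
    by_cases hij : i = j
    · subst hij; simp
    · simp [hij]
  change hform (Pi.single i 1 - (ω * hform (Pi.single i 1) u) • u)
    (Pi.single j 1 - (ω * hform (Pi.single j 1) u) • u) = _
  rw [hform_sub_smul_sub_smul, hij, star_mul', star_hform]
  linear_combination (-hform (Pi.single i 1) u * hform u (Pi.single j 1)) * h

theorem det_quasiReflection (ω : R) (u : Fin (n + 1) → R) :
    (quasiReflection ω u).det = 1 - ω * hform u u := by
  have : quasiReflection ω u = 1 - Matrix.replicateCol Unit (fun i => ω * hform (Pi.single i 1) u) *
      Matrix.replicateRow Unit u := by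
    ext i j
    simp [quasiReflection, Matrix.one_apply, Matrix.mul_apply, Pi.single_apply, eq_comm]
  rw [this, Matrix.det_one_sub_mul_comm]
  simp only [Matrix.det_unique, Matrix.sub_apply, Matrix.one_apply_eq, Matrix.mul_apply,
    Matrix.replicateRow_apply, Matrix.replicateCol_apply, hform_single_left]
  rw [hform, Finset.mul_sum]
  congr 1
  exact Finset.sum_congr rfl fun i _ => by ring

variable {ρ : R →+* ZMod 2} (hstar : ∀ x, ρ (star x) = ρ x) (hunit : ∀ x, ρ x = 1 → IsUnit x)
include hstar hunit

/-- Two unit vectors whose product is not a unit are exchanged by a quasi-reflection. -/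
theorem exists_isUnitaryM_vecMul_eq {x y : Fin (n + 1) → R} (hx : hform x x = 1)
    (hy : hform y y = 1) (hxy : ρ (hform x y) = 0) :
    ∃ g : Matrix (Fin (n + 1)) (Fin (n + 1)) R,
      IsUnitaryM g ∧ IsUnit g.det ∧ x ᵥ* g = y := by
  set t := hform x y with ht
  have h1 : ρ (1 - t) = 1 := by simp [hxy]
  obtain ⟨ω, hω⟩ := (hunit _ h1).exists_right_inv
  have hω' : (1 - star t) * star ω = 1 := by
    have := congrArg star hω
    simpa [mul_comm] using this
  have hyx : hform y x = star t := (star_hform x y).symm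
  have hu : hform (x - (1 : R) • y) (x - (1 : R) • y) = 2 - t - star t := by
    rw [hform_sub_smul_sub_smul, hx, hy, hyx, ← ht, star_one]
    ring
  have hxu : hform x (x - (1 : R) • y) = 1 - t := by
    have := hform_sub_smul_sub_smul x x y 0 1
    rw [zero_smul, sub_zero, hx, ← ht, star_one] at this
    rw [this]
    ring
  refine ⟨quasiReflection ω (x - (1 : R) • y), isUnitaryM_quasiReflection ?_, hunit _ ?_, ?_⟩
  · rw [hu]
    linear_combination (-star ω) * hω - ω * hω'
  · have h2 : ρ 2 = 0 := by rw [map_ofNat]; rfl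
    rw [det_quasiReflection, hu]
    simp [hstar, hxy, h2]
  · rw [vecMul_quasiReflection, hxu, mul_comm, hω, one_smul, one_smul, sub_sub_cancel]

theorem exists_isUnitaryM_row_zero {w : Fin (n + 2) → R} (hw : hform w w = 1) {i : Fin (n + 1)}
    (hi : ρ (w i.castSucc) = 0) :
    ∃ g : Matrix (Fin (n + 2)) (Fin (n + 2)) R, IsUnitaryM g ∧ g.det = 1 ∧ g 0 = w := by
  have hd (j : Fin (n + 1)) : diagCoeff R (n + 1) j.castSucc = 1 := by
    simp [diagCoeff, (Fin.castSucc_lt_last j).ne]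
  have hs (j : Fin (n + 1)) :
      hform (Pi.single j.castSucc 1 : Fin (n + 2) → R) (Pi.single j.castSucc 1) = 1 := by
    simp [hform_single_right, hd]
  obtain ⟨g₁, hg₁, hd₁, he₁⟩ : ∃ g : Matrix (Fin (n + 2)) (Fin (n + 2)) R,
      IsUnitaryM g ∧ IsUnit g.det ∧
        (Pi.single (Fin.castSucc 0) 1 : Fin (n + 2) → R) ᵥ* g = Pi.single i.castSucc 1 := by
    by_cases h0 : i = 0
    · refine ⟨1, ?_, by simp, by simp [h0]⟩
      simp [IsUnitaryM]
    · refine exists_isUnitaryM_vecMul_eq hstar hunit (hs 0) (hs i) ?_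
      rw [hform_single_right, hd, Pi.single_eq_of_ne]
      · simp
      · simpa using h0
  obtain ⟨g₂, hg₂, hd₂, he₂⟩ := exists_isUnitaryM_vecMul_eq hstar hunit (hs i) hw
    (by rw [hform_single_left, hd, one_mul, hstar, hi])
  set g := g₁ * g₂ with hg
  have hgU : IsUnitaryM g := hg₁.mul hg₂
  have hgd : IsUnit g.det := by rw [hg, Matrix.det_mul]; exact hd₁.mul hd₂
  have hg0 : g 0 = w := by
    have h : (Pi.single 0 1 : Fin (n + 2) → R) ᵥ* g = w := by
      rw [hg, ← Matrix.vecMul_vecMul, ← he₂, ← he₁, Fin.castSucc_zero]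
    simpa [Matrix.row] using h
  obtain ⟨δ, hδ⟩ := hgd.exists_right_inv
  have hδ' : star g.det * star δ = 1 := by
    have := congrArg star hδ
    simpa [mul_comm] using this
  have hMdet : (Mmat R (n + 1)).det = -2 := by
    simp [Mmat, Finset.prod_ite_eq']
  have hdet : g.det * -2 * star g.det = -2 := by
    have := congrArg Matrix.det hgU
    rwa [Matrix.det_mul, Matrix.det_mul, Matrix.det_conjTranspose, hMdet] at this
  let D : Matrix (Fin (n + 2)) (Fin (n + 2)) R :=
    Matrix.diagonal fun j => if j = Fin.last (n + 1) then δ else 1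
  have hDU : IsUnitaryM D := by
    rw [IsUnitaryM, Matrix.diagonal_conjTranspose, Mmat, Matrix.diagonal_mul_diagonal,
      Matrix.diagonal_mul_diagonal]
    congr 1
    ext j
    by_cases hj : j = Fin.last (n + 1)
    · simp only [hj, if_true, Pi.star_apply]
      linear_combination (-δ * star δ) * hdet - 2 * star g.det * star δ * hδ - 2 * hδ'
    · simp [hj]
  have hDdet : D.det = δ := by simp [D]
  refine ⟨D * g, hDU.mul hgU, ?_, ?_⟩
  · rw [Matrix.det_mul, hDdet, mul_comm, hδ]
  · ext j
    rw [Matrix.diagonal_mul, if_neg (Fin.last_pos).ne, one_mul, hg0]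

end Transitivity

/-! ### Recursion on the size: fibering `SU(M)` over the first row -/

section OneBlock

variable {R : Type*} [CommRing R] {n : ℕ}

/-- The block matrix `1 ⊕ A`. -/
def oneBlock (A : Matrix (Fin (n + 1)) (Fin (n + 1)) R) : Matrix (Fin (n + 2)) (Fin (n + 2)) R :=
  Matrix.of (Fin.cons (Fin.cons 1 0 : Fin (n + 2) → R)
    (fun i => (Fin.cons 0 (A i) : Fin (n + 2) → R)))

theorem oneBlock_zero (A : Matrix (Fin (n + 1)) (Fin (n + 1)) R) :
    oneBlock A 0 = (Fin.cons 1 0 : Fin (n + 2) → R) := rfl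

theorem oneBlock_succ (A : Matrix (Fin (n + 1)) (Fin (n + 1)) R) (i : Fin (n + 1)) :
    oneBlock A i.succ = (Fin.cons 0 (A i) : Fin (n + 2) → R) := rfl

theorem oneBlock_injective :
    Function.Injective (oneBlock : Matrix (Fin (n + 1)) (Fin (n + 1)) R → _) := by
  intro A B h
  ext i j
  have := congrFun (congrFun h i.succ) j.succ
  simpa [oneBlock_succ] using this

theorem det_oneBlock (A : Matrix (Fin (n + 1)) (Fin (n + 1)) R) :
    (oneBlock A).det = A.det := by
  rw [Matrix.det_succ_row_zero, Finset.sum_eq_single 0]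
  · have : (oneBlock A).submatrix Fin.succ (Fin.succAbove 0) = A := by
      ext i j
      simp [oneBlock_succ]
    rw [this, oneBlock_zero]
    simp
  · intro j _ hj
    obtain ⟨k, rfl⟩ := Fin.exists_succ_eq.mpr hj
    simp [oneBlock_zero]
  · simp

end OneBlock

section Recursion

variable {R : Type*} [CommRing R] [StarRing R] {n : ℕ}

/-- The vectors that occur as first row of a matrix in `SU(M)`. -/
def IsFirstRow (ρ : R →+* ZMod 2) (w : Fin (n + 2) → R) : Prop :=
  hform w w = 1 ∧ (n = 0 ∨ ∃ i : Fin (n + 1), ρ (w i.castSucc) = 0)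

theorem isUnitaryM_oneBlock_iff {A : Matrix (Fin (n + 1)) (Fin (n + 1)) R} :
    IsUnitaryM (oneBlock A) ↔ IsUnitaryM A := by
  have h0 : (0 : Fin (n + 2)) ≠ Fin.last (n + 1) := (Fin.last_pos).ne
  have hs (i : Fin (n + 1)) : diagCoeff R (n + 1) i.succ = diagCoeff R n i := by
    simp only [diagCoeff, ← Fin.succ_last, Fin.succ_inj]
  have hz (x : Fin (n + 1) → R) : hform 0 x = 0 ∧ hform x 0 = 0 := by simp [hform]
  simp only [isUnitaryM_iff, Fin.forall_fin_succ (n := n + 1), oneBlock_zero, oneBlock_succ,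
    hform_vecCons, hs, Fin.succ_inj, (hz _).1, (hz _).2]
  simp [diagCoeff, h0, (Fin.succ_ne_zero _).symm]

theorem eq_oneBlock {B : Matrix (Fin (n + 2)) (Fin (n + 2)) R} (hB : IsUnitaryM B)
    (h0 : B 0 = (Pi.single 0 1 : Fin (n + 2) → R)) :
    B = oneBlock (B.submatrix Fin.succ Fin.succ) := by
  have hd : diagCoeff R (n + 1) 0 = 1 := if_neg (Fin.last_pos).ne
  ext i j
  refine Fin.cases ?_ (fun i => ?_) i
  · rw [h0, oneBlock_zero]
    refine Fin.cases ?_ (fun j => ?_) j <;> simp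
  · rw [oneBlock_succ]
    refine Fin.cases ?_ (fun j => ?_) j
    · have := isUnitaryM_iff.mp hB i.succ 0
      rw [h0, hform_single_right, hd, mul_one, if_neg (Fin.succ_ne_zero i)] at this
      simpa using this
    · simp

variable {ρ : R →+* ZMod 2} (hstar : ∀ x, ρ (star x) = ρ x) (hunit : ∀ x, ρ x = 1 → IsUnit x)

theorem isUnitaryM_fin_two {w : Fin 2 → R} (hw : hform (n := 1) w w = 1) :
    IsUnitaryM (n := 1) !![w 0, w 1; 2 * star (w 1), star (w 0)] ∧
      (!![w 0, w 1; 2 * star (w 1), star (w 0)]).det = 1 := by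
  have h : w 0 * star (w 0) - 2 * (w 1 * star (w 1)) = 1 := by
    rw [← hw, hform, Fin.sum_univ_two]
    simp [diagCoeff]
    ring
  constructor
  · rw [isUnitaryM_iff]
    simp [hform, Fin.sum_univ_two, Fin.forall_fin_two, diagCoeff]
    refine ⟨⟨?_, ?_⟩, ?_, ?_⟩
    · linear_combination h
    · ring
    · ring
    · linear_combination (-2) * h
  · rw [Matrix.det_fin_two_of]
    linear_combination h

include hstar in
theorem isFirstRow_row_zero {A : Matrix (Fin (n + 2)) (Fin (n + 2)) R} (hA : IsUnitaryM A) :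
    IsFirstRow ρ (A 0) := by
  rw [isUnitaryM_iff] at hA
  have hd (j : Fin (n + 1)) : diagCoeff R (n + 1) j.castSucc = 1 := by
    simp [diagCoeff, (Fin.castSucc_lt_last j).ne]
  have h2 : ρ 2 = 0 := by rw [map_ofNat]; rfl
  have hlast : ρ (diagCoeff R (n + 1) (Fin.last (n + 1))) = 0 := by simp [diagCoeff, h2]
  refine ⟨by simpa using (hA 0 0).trans (by rw [if_pos rfl]; exact hd 0), ?_⟩
  by_contra! hcon
  obtain ⟨hn, hw⟩ := hcon
  obtain ⟨m, rfl⟩ := Nat.exists_eq_succ_of_ne_zero hn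
  have hone (i : Fin (m + 2)) : ρ (A 0 i.castSucc) = 1 := by
    have key : ∀ a : ZMod 2, a ≠ 0 → a = 1 := by decide
    exact key _ (hw i)
  have hsq : ∀ a : ZMod 2, a * a = a := by decide
  have h10 : (1 : Fin (m + 3)) ≠ 0 := by simp
  have e1 := congrArg ρ (hA 1 0)
  have e2 := congrArg ρ (hA 1 1)
  rw [if_neg h10, hform, Fin.sum_univ_castSucc] at e1
  rw [if_pos rfl, hform, Fin.sum_univ_castSucc] at e2
  simp only [map_add, map_sum, map_mul, hstar, hd, hlast, hone, mul_one, mul_zero,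
    zero_mul, add_zero, hsq, map_zero] at e1 e2
  rw [e1] at e2
  have : diagCoeff R (m + 2) 1 = 1 := by
    have := hd 1
    rwa [Fin.castSucc_one] at this
  rw [this] at e2
  simp at e2

include hstar hunit in
theorem IsFirstRow.exists_row_zero {w : Fin (n + 2) → R} (hw : IsFirstRow ρ w) :
    ∃ g : Matrix (Fin (n + 2)) (Fin (n + 2)) R, (IsUnitaryM g ∧ g.det = 1) ∧ g 0 = w := by
  obtain ⟨hw, rfl | ⟨i, hi⟩⟩ := hw
  · refine ⟨_, isUnitaryM_fin_two hw, ?_⟩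
    ext j
    fin_cases j <;> rfl
  · obtain ⟨g, h1, h2, h3⟩ := exists_isUnitaryM_row_zero hstar hunit hw hi
    exact ⟨g, ⟨h1, h2⟩, h3⟩

include hstar hunit in
theorem card_specialUnitary_succ :
    Nat.card {A : Matrix (Fin (n + 2)) (Fin (n + 2)) R // IsUnitaryM A ∧ A.det = 1} =
      Nat.card {w : Fin (n + 2) → R // IsFirstRow ρ w} *
        Nat.card {A : Matrix (Fin (n + 1)) (Fin (n + 1)) R // IsUnitaryM A ∧ A.det = 1} := by
  have hex (w : {w : Fin (n + 2) → R // IsFirstRow ρ w}) :=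
    w.2.exists_row_zero hstar hunit
  choose g hg hg0 using hex
  rw [← Nat.card_prod]
  symm
  refine Nat.card_eq_of_bijective (fun p => ⟨oneBlock p.2.1 * g p.1,
    (isUnitaryM_oneBlock_iff.mpr p.2.2.1).mul (hg p.1).1, by
      rw [Matrix.det_mul, det_oneBlock, p.2.2.2, (hg p.1).2, one_mul]⟩) ⟨?_, ?_⟩
  · rintro ⟨w, A⟩ ⟨w', A'⟩ h
    have h : oneBlock A.1 * g w = oneBlock A'.1 * g w' := congrArg Subtype.val h
    have hrow (w : {w : Fin (n + 2) → R // IsFirstRow ρ w})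
        (A : Matrix (Fin (n + 1)) (Fin (n + 1)) R) : (oneBlock A * g w) 0 = w.1 := by
      rw [← hg0 w]
      ext j
      simp [Matrix.mul_apply, oneBlock_zero, Fin.sum_univ_succ]
    have hww : w = w' := by
      apply Subtype.ext
      rw [← hrow w A.1, h, hrow]
    subst hww
    have hu : IsUnit (g w).det := by rw [(hg w).2]; exact isUnit_one
    have := congrArg (· * (g w)⁻¹) h
    simp only [Matrix.mul_nonsing_inv_cancel_right _ _ hu] at this
    rw [Subtype.ext (oneBlock_injective this)]
  · rintro ⟨A, hA, hdet⟩
    let w : {w : Fin (n + 2) → R // IsFirstRow ρ w} := ⟨A 0, isFirstRow_row_zero hstar hA⟩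
    have hu : IsUnit (g w).det := by rw [(hg w).2]; exact isUnit_one
    have hB : IsUnitaryM (A * (g w)⁻¹) := hA.mul ((hg w).1.inv hu)
    have hBdet : (A * (g w)⁻¹).det = 1 := by
      rw [Matrix.det_mul, hdet, Matrix.det_nonsing_inv, (hg w).2, Ring.inverse_one, one_mul]
    have hB0 : (A * (g w)⁻¹) 0 = (Pi.single 0 1 : Fin (n + 2) → R) := by
      have h1 : (A * (g w)⁻¹) 0 = (g w * (g w)⁻¹) 0 := by
        ext j
        simp only [Matrix.mul_apply, hg0 w, w]
      rw [h1, Matrix.mul_nonsing_inv _ hu]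
      ext j
      simp [Matrix.one_apply, Pi.single_apply, eq_comm]
    have hblock := eq_oneBlock hB hB0
    refine ⟨⟨w, ⟨(A * (g w)⁻¹).submatrix Fin.succ Fin.succ, ?_, ?_⟩⟩, ?_⟩
    · rwa [← isUnitaryM_oneBlock_iff, ← hblock]
    · rwa [← det_oneBlock, ← hblock]
    · apply Subtype.ext
      simp only
      rw [← hblock, Matrix.nonsing_inv_mul_cancel_right _ _ hu]

theorem card_specialUnitary_zero :
    Nat.card {A : Matrix (Fin (0 + 1)) (Fin (0 + 1)) R // IsUnitaryM A ∧ A.det = 1} = 1 := by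
  rw [Nat.card_eq_one_iff_unique]
  have : Subsingleton (Fin (0 + 1)) := inferInstanceAs (Subsingleton (Fin 1))
  refine ⟨⟨fun A B => Subtype.ext ?_⟩, ⟨⟨1, ?_, Matrix.det_one⟩⟩⟩
  · have hA := A.2.2
    have hB := B.2.2
    rw [Matrix.det_fin_one] at hA hB
    ext i j
    rw [Subsingleton.elim i 0, Subsingleton.elim j 0]
    exact hA.trans hB.symm
  · simp [IsUnitaryM]

end Recursion

/-! ### Counting first rows -/

/-- The number of binary vectors with odd sum, the all-one vector being excluded unless it is
the only one. -/
theorem card_binary_sum_eq_one (n : ℕ) :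
    Nat.card {s : Fin (n + 1) → ZMod 2 // ∑ i, s i = 1 ∧ (n = 0 ∨ ∃ i, s i = 0)} =
      2 ^ n - if n ≠ 0 ∧ Even n then 1 else 0 := by
  classical
  have hcount : (Finset.univ.filter fun s : Fin (n + 1) → ZMod 2 => ∑ i, s i = 1).card = 2 ^ n := by
    have e : {s : Fin (n + 1) → ZMod 2 // ∑ i, s i = 1} ≃ (Fin n → ZMod 2) :=
      { toFun := fun s => Fin.tail s.1
        invFun := fun t => ⟨Fin.cons (1 - ∑ i, t i) t, by simp [Fin.sum_univ_succ]⟩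
        left_inv := by
          rintro ⟨s, hs⟩
          apply Subtype.ext
          rw [Fin.sum_univ_succ] at hs
          ext i
          refine Fin.cases ?_ (fun j => ?_) i
          · simp only [Fin.tail, Fin.cons_zero]
            rw [← hs, add_sub_cancel_right]
          · simp [Fin.tail]
        right_inv := fun t => by simp }
    rw [← Fintype.card_subtype, Fintype.card_congr e]
    simp
  rcases Nat.eq_zero_or_pos n with rfl | hn
  · simp only [true_or, and_true, ne_eq, not_true_eq_false, false_and, if_false]
    rw [Nat.card_eq_fintype_card, Fintype.card_subtype, hcount]
    simp
  · have hn0 : n ≠ 0 := hn.ne'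
    have herase : (Finset.univ.filter fun s : Fin (n + 1) → ZMod 2 =>
        ∑ i, s i = 1 ∧ (n = 0 ∨ ∃ i, s i = 0)) =
        (Finset.univ.filter fun s : Fin (n + 1) → ZMod 2 => ∑ i, s i = 1).erase (fun _ => 1) := by
      ext s
      have key : ∀ a : ZMod 2, ¬ a = 0 ↔ a = 1 := by decide
      simp only [hn0, false_or, Finset.mem_filter, Finset.mem_univ, true_and, Finset.mem_erase,
        ne_eq, funext_iff, ← key]
      push Not
      tauto
    have hmem : (fun _ => 1) ∈ (Finset.univ.filter fun s : Fin (n + 1) → ZMod 2 => ∑ i, s i = 1) ↔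
        Even n := by
      simp only [Finset.mem_filter, Finset.mem_univ, true_and, Finset.sum_const,
        Finset.card_univ, Fintype.card_fin, nsmul_eq_mul, mul_one, Nat.cast_add, Nat.cast_one]
      rw [add_eq_right, ZMod.natCast_eq_zero_iff_even]
    rw [Nat.card_eq_fintype_card, Fintype.card_subtype, herase, Finset.card_erase_eq_ite, hcount]
    simp only [hmem, hn0, ne_eq, not_false_eq_true, true_and]
    split_ifs <;> simp

section FirstRows

variable {R : Type*} [CommRing R] [StarRing R] [Finite R]

/-- The numerical data of the norm map of `ℤ[√-d]/(32)` used to count first rows. -/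
structure NormData (R : Type*) [CommRing R] [StarRing R] where
  /-- reduction modulo the prime above `2` -/
  ρ : R →+* ZMod 2
  /-- the structure map of the base ring -/
  ι : ZMod 32 →+* R
  /-- the norm -/
  nm : R → ZMod 32
  ι_injective : Function.Injective ι
  mul_star_eq : ∀ x, x * star x = ι (nm x)
  cast_nm : ∀ x, ZMod.castHom (by norm_num : 2 ∣ 32) (ZMod 2) (nm x) = ρ x
  ρ_star : ∀ x, ρ (star x) = ρ x
  card_fiber : ∀ s, Nat.card {x : R // ρ x = s} = 2 ^ 9
  card_pairs : ∀ c : ZMod 32, ZMod.castHom (by norm_num : 2 ∣ 32) (ZMod 2) c = 1 →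
    Nat.card {p : R × R // nm p.1 - 2 * nm p.2 = c} = 2 ^ 15

namespace NormData

variable (N : NormData R) {n : ℕ}

omit [Finite R] in
theorem isUnit_of_ρ_eq_one (x : R) (hx : N.ρ x = 1) : IsUnit x := by
  have key : ∀ c : ZMod 32, ZMod.castHom (by norm_num : 2 ∣ 32) (ZMod 2) c = 1 →
      ∃ c', c * c' = 1 := by decide
  obtain ⟨c', hc'⟩ := key (N.nm x) (by rw [N.cast_nm, hx])
  refine IsUnit.of_mul_eq_one (star x * N.ι c') ?_
  rw [← mul_assoc, N.mul_star_eq, ← map_mul, hc', map_one]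

omit [Finite R] in
theorem hform_self (v : Fin n → R) (b : R) :
    hform (Fin.snoc v b : Fin (n + 1) → R) (Fin.snoc v b : Fin (n + 1) → R) =
      N.ι (∑ i, N.nm (v i) - 2 * N.nm b) := by
  rw [hform, Fin.sum_univ_castSucc]
  simp only [Fin.snoc_castSucc, Fin.snoc_last, diagCoeff, (Fin.castSucc_lt_last _).ne, if_false,
    if_true, mul_one, N.mul_star_eq, map_sub, map_sum, map_mul, map_ofNat]
  rw [← N.mul_star_eq]
  ring

theorem card_lifts (s : Fin (n + 1) → ZMod 2) (hs : ∑ i, s i = 1) :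
    Nat.card {p : (Fin (n + 1) → R) × R // (∀ i, N.ρ (p.1 i) = s i) ∧
      ∑ i, N.nm (p.1 i) - 2 * N.nm p.2 = 1} = 2 ^ (9 * n + 15) := by
  classical
  obtain ⟨k, hk⟩ : ∃ k, s k = 1 := by
    by_contra! h
    have key : ∀ a : ZMod 2, a ≠ 1 → a = 0 := by decide
    rw [Finset.sum_eq_zero fun i _ => key _ (h i)] at hs
    exact absurd hs (by decide)
  have hsk : ∑ j, s (k.succAbove j) = 0 := by
    rw [Fin.sum_univ_succAbove s k, hk] at hs
    simpa using hs
  have h20 : (2 : ZMod 2) = 0 := rfl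
  have hcast (v : Fin n → R) (hv : ∀ j, N.ρ (v j) = s (k.succAbove j)) :
      ZMod.castHom (by norm_num : 2 ∣ 32) (ZMod 2) (1 - ∑ j, N.nm (v j)) = 1 := by
    rw [map_sub, map_one, map_sum]
    simp only [N.cast_nm, hv, hsk, sub_zero]
  let e : {p : (Fin (n + 1) → R) × R // (∀ i, N.ρ (p.1 i) = s i) ∧
      ∑ i, N.nm (p.1 i) - 2 * N.nm p.2 = 1} ≃
      Σ v : {v : Fin n → R // ∀ j, N.ρ (v j) = s (k.succAbove j)},
        {p : R × R // N.nm p.1 - 2 * N.nm p.2 = 1 - ∑ j, N.nm (v.1 j)} :=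
    { toFun := fun p => ⟨⟨fun j => p.1.1 (k.succAbove j), fun j => p.2.1 _⟩,
        ⟨(p.1.1 k, p.1.2), by
          have := p.2.2
          rw [Fin.sum_univ_succAbove _ k] at this
          linear_combination this⟩⟩
      invFun := fun q => ⟨(k.insertNth q.2.1.1 q.1.1, q.2.1.2), by
        constructor
        · rw [Fin.forall_iff_succAbove k]
          refine ⟨?_, fun j => ?_⟩
          · have h := congrArg (ZMod.castHom (by norm_num : 2 ∣ 32) (ZMod 2)) q.2.2
            rw [hcast _ q.1.2, map_sub, map_mul, map_ofNat, h20, zero_mul, sub_zero,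
              N.cast_nm] at h
            simpa [hk] using h
          · simpa using q.1.2 j
        · rw [Fin.sum_univ_succAbove _ k]
          simp only [Fin.insertNth_apply_same, Fin.insertNth_apply_succAbove]
          linear_combination q.2.2⟩
      left_inv := by
        rintro ⟨⟨v, b⟩, h⟩
        apply Subtype.ext
        refine Prod.ext ?_ rfl
        exact Fin.insertNth_self_removeNth k v
      right_inv := by
        rintro ⟨⟨v, hv⟩, ⟨⟨a, b⟩, h⟩⟩
        refine Sigma.subtype_ext ?_ ?_ <;> simp }
  have hfib : Nat.card {v : Fin n → R // ∀ j, N.ρ (v j) = s (k.succAbove j)} = 2 ^ (9 * n) := by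
    rw [Nat.card_congr (Equiv.subtypePiEquivPi (p := fun j x => N.ρ x = s (k.succAbove j))),
      Nat.card_pi]
    simp [N.card_fiber, pow_mul]
  have := Fintype.ofFinite {v : Fin n → R // ∀ j, N.ρ (v j) = s (k.succAbove j)}
  rw [Nat.card_congr e, Nat.card_sigma, Finset.sum_congr rfl fun v _ => N.card_pairs _ (hcast _ v.2),
    Finset.sum_const, Finset.card_univ, ← Nat.card_eq_fintype_card, hfib, smul_eq_mul, pow_add]

theorem card_isFirstRow :
    Nat.card {w : Fin (n + 2) → R // IsFirstRow N.ρ w} =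
      (2 ^ n - if n ≠ 0 ∧ Even n then 1 else 0) * 2 ^ (9 * n + 15) := by
  classical
  let S := {s : Fin (n + 1) → ZMod 2 // ∑ i, s i = 1 ∧ (n = 0 ∨ ∃ i, s i = 0)}
  let e : {w : Fin (n + 2) → R // IsFirstRow N.ρ w} ≃
      Σ s : S, {p : (Fin (n + 1) → R) × R // (∀ i, N.ρ (p.1 i) = s.1 i) ∧
        ∑ i, N.nm (p.1 i) - 2 * N.nm p.2 = 1} :=
    { toFun := fun w =>
        have h : ∑ i : Fin (n + 1), N.nm (w.1 i.castSucc) - 2 * N.nm (w.1 (Fin.last _)) = 1 := by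
          have := w.2.1
          rw [← Fin.snoc_init_self w.1, N.hform_self] at this
          exact N.ι_injective (this.trans (map_one _).symm)
        ⟨⟨fun i => N.ρ (w.1 i.castSucc), by
          have h' := congrArg (ZMod.castHom (by norm_num : 2 ∣ 32) (ZMod 2)) h
          have h20 : (2 : ZMod 2) = 0 := rfl
          rw [map_sub, map_sum, map_mul, map_ofNat, h20, zero_mul, sub_zero, map_one] at h'
          simpa only [N.cast_nm] using h', w.2.2⟩,
        ⟨(fun i => w.1 i.castSucc, w.1 (Fin.last _)), fun _ => rfl, h⟩⟩
      invFun := fun q => ⟨(Fin.snoc q.2.1.1 q.2.1.2 : Fin (n + 2) → R), by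
        rw [N.hform_self, q.2.2.2, map_one], by
        simpa [q.2.2.1] using q.1.2.2⟩
      left_inv := fun w => Subtype.ext (Fin.snoc_init_self w.1)
      right_inv := by
        rintro ⟨⟨s, hs⟩, ⟨⟨v, b⟩, h, h'⟩⟩
        obtain rfl : (fun i => N.ρ (v i)) = s := funext h
        refine Sigma.subtype_ext ?_ ?_ <;> simp }
  rw [Nat.card_congr e, Nat.card_sigma, Finset.sum_congr rfl fun s _ => N.card_lifts _ s.2.1,
    Finset.sum_const, Finset.card_univ, ← Nat.card_eq_fintype_card, card_binary_sum_eq_one,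
    smul_eq_mul]

include N in
theorem card_specialUnitary (n : ℕ) :
    (Nat.card {A : Matrix (Fin (n + 1)) (Fin (n + 1)) R // IsUnitaryM A ∧ A.det = 1} : ℚ) =
      2 ^ (5 * (n + 1) ^ 2 - 5) *
        ∏ i ∈ Finset.Icc 1 ((n - 1) / 2), (1 - (2 : ℚ) ^ (-(2 * (i : ℤ)))) := by
  induction n with
  | zero => rw [card_specialUnitary_zero]; simp
  | succ n ih =>
    rw [card_specialUnitary_succ N.ρ_star N.isUnit_of_ρ_eq_one, N.card_isFirstRow, Nat.cast_mul,
      ih]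
    have hexp : 5 * (n + 1 + 1) ^ 2 - 5 = (5 * (n + 1) ^ 2 - 5) + (9 * n + 15) + n := by
      have h1 : 5 * (n + 1 + 1) ^ 2 = 5 * (n + 1) ^ 2 + (10 * n + 15) := by ring
      have h2 : 1 ≤ (n + 1) ^ 2 := Nat.one_le_pow _ _ n.succ_pos
      omega
    rw [hexp]
    generalize 5 * (n + 1) ^ 2 - 5 = E
    generalize 9 * n + 15 = F
    rw [pow_add, pow_add]
    by_cases h : n ≠ 0 ∧ Even n
    · obtain ⟨h0, k, rfl⟩ := h
      obtain ⟨j, rfl⟩ := Nat.exists_eq_succ_of_ne_zero (by omega : k ≠ 0)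
      have h1 : (j.succ + j.succ - 1) / 2 = j := by omega
      have h2 : (j.succ + j.succ + 1 - 1) / 2 = j + 1 := by omega
      rw [if_pos ⟨h0, j.succ, rfl⟩, h1, h2, Finset.prod_Icc_succ_top (by omega)]
      have h3 : (2 : ℚ) ^ (-(2 * ((j + 1 : ℕ) : ℤ))) = (2 ^ (j.succ + j.succ))⁻¹ := by
        rw [_root_.zpow_neg, ← zpow_natCast]
        congr 2
        push_cast
        ring
      rw [h3]
      push_cast [Nat.cast_sub Nat.one_le_two_pow]
      field_simp
    · have h1 : (n + 1 - 1) / 2 = (n - 1) / 2 := by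
        rcases Nat.even_or_odd n with hn | ⟨k, rfl⟩
        · have : n = 0 := by tauto
          subst this; rfl
        · omega
      rw [if_neg h, h1, Nat.sub_zero]
      push_cast
      ring

end NormData

end FirstRows

/-! ### The norm form of `ℤ[√-d]/(32)` -/

section NormForm

theorem card_residue_fiber : ∀ s : ZMod 2,
    (Finset.univ.filter fun x : ZMod 32 × ZMod 32 =>
      ZMod.castHom (by norm_num : 2 ∣ 32) (ZMod 2) (x.1 + x.2) = s).card = 512 := by
  decide +kernel

theorem natCard_residue_fiber (s : ZMod 2) :
    Nat.card {x : ZMod 32 × ZMod 32 //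
      ZMod.castHom (by norm_num : 2 ∣ 32) (ZMod 2) (x.1 + x.2) = s} = 2 ^ 9 := by
  rw [Nat.card_eq_fintype_card, Fintype.card_subtype, card_residue_fiber]
  norm_num

theorem card_odd_sq_eq : ∀ c : ZMod 32,
    (Finset.univ.filter fun x : ZMod 32 => x.val % 2 = 1 ∧ x ^ 2 = c).card =
      if c.val % 8 = 1 then 4 else 0 := by
  decide +kernel

theorem card_norm_fiber {D : ZMod 32} (hD : D.val % 4 = 1) {c : ZMod 32} (hc : c.val % 2 = 1) :
    (Finset.univ.filter fun x : ZMod 32 × ZMod 32 => x.1 ^ 2 + D * x.2 ^ 2 = c).card =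
      if c.val % 4 = 1 then 64 else 0 := by
  have hinv : D ^ 7 * D = 1 := by revert D; decide +kernel
  have hD2 : D.val % 2 = 1 := by omega
  have hparity : ∀ a b : ZMod 32, (a + b).val % 2 = (a.val + b.val) % 2 := by decide +kernel
  have hmul : ∀ a b : ZMod 32, a.val % 2 = 1 → (a * b).val % 2 = b.val % 2 := by decide +kernel
  have hsq : ∀ a : ZMod 32, (a ^ 2).val % 2 = a.val % 2 := by decide +kernel
  have hxy (x y : ZMod 32) (h : x ^ 2 + D * y ^ 2 = c) : (x.val + y.val) % 2 = 1 := by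
    have h1 := hparity (x ^ 2) (D * y ^ 2)
    rw [h, Nat.add_mod, hsq, hmul _ _ hD2, hsq, hc, ← Nat.add_mod] at h1
    exact h1.symm
  have hpoint (x y : ZMod 32) : (if x ^ 2 + D * y ^ 2 = c then 1 else 0) =
      (if x.val % 2 = 1 ∧ x ^ 2 = c - D * y ^ 2 then 1 else 0) +
        if y.val % 2 = 1 ∧ y ^ 2 = D ^ 7 * (c - x ^ 2) then 1 else 0 := by
    have e1 : x ^ 2 = c - D * y ^ 2 ↔ x ^ 2 + D * y ^ 2 = c := eq_sub_iff_add_eq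
    have e2 : y ^ 2 = D ^ 7 * (c - x ^ 2) ↔ x ^ 2 + D * y ^ 2 = c := by
      constructor
      · intro h
        linear_combination D * h + (c - x ^ 2) * hinv
      · intro h
        linear_combination D ^ 7 * h - y ^ 2 * hinv
    simp only [e1, e2]
    by_cases h : x ^ 2 + D * y ^ 2 = c
    · have := hxy x y h
      simp only [h, and_true, if_true]
      split_ifs <;> omega
    · simp [h]
  rw [Finset.card_filter, Fintype.sum_prod_type]
  simp only [hpoint, Finset.sum_add_distrib]
  rw [Finset.sum_comm]
  simp only [← Finset.card_filter, card_odd_sq_eq]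
  have hfinal : ∀ D : ZMod 32, D.val % 4 = 1 → ∀ c : ZMod 32, c.val % 2 = 1 →
      (∑ y, if (c - D * y ^ 2).val % 8 = 1 then 4 else 0) +
        (∑ x, if (D ^ 7 * (c - x ^ 2)).val % 8 = 1 then 4 else 0) =
      if c.val % 4 = 1 then 64 else 0 := by
    decide +kernel
  exact hfinal D hD c hc

theorem card_add_two_mul_norm {D : ZMod 32} (hD : D.val % 4 = 1) {c : ZMod 32}
    (hc : c.val % 2 = 1) :
    (Finset.univ.filter fun x : ZMod 32 × ZMod 32 =>
      (c + 2 * (x.1 ^ 2 + D * x.2 ^ 2)).val % 4 = 1).card = 512 := by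
  have hmod : ∀ c m : ZMod 32, c.val % 2 = 1 → ((c + 2 * m).val % 4 = 1 ↔
      ZMod.castHom (by norm_num : 2 ∣ 32) (ZMod 2) m = if c.val % 4 = 1 then 0 else 1) := by
    decide +kernel
  have hD1 : ZMod.castHom (by norm_num : 2 ∣ 32) (ZMod 2) D = 1 := by
    revert D
    decide +kernel
  have hsq : ∀ a : ZMod 2, a ^ 2 = a := by decide
  simp only [hmod _ _ hc, map_add, map_mul, map_pow, hD1, one_mul, hsq]
  simp only [← map_add]
  exact card_residue_fiber _

theorem card_norm_pairs {D : ZMod 32} (hD : D.val % 4 = 1) {c : ZMod 32}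
    (hc : ZMod.castHom (by norm_num : 2 ∣ 32) (ZMod 2) c = 1) :
    Nat.card {p : (ZMod 32 × ZMod 32) × (ZMod 32 × ZMod 32) //
      (p.1.1 ^ 2 + D * p.1.2 ^ 2) - 2 * (p.2.1 ^ 2 + D * p.2.2 ^ 2) = c} = 2 ^ 15 := by
  have hc2 : c.val % 2 = 1 := by revert c; decide
  have hodd : ∀ c y : ZMod 32, c.val % 2 = 1 → (c + 2 * y).val % 2 = 1 := by decide +kernel
  have key (y : ZMod 32 × ZMod 32) :
      (Finset.univ.filter fun x : ZMod 32 × ZMod 32 =>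
        (x.1 ^ 2 + D * x.2 ^ 2) - 2 * (y.1 ^ 2 + D * y.2 ^ 2) = c).card =
      if (c + 2 * (y.1 ^ 2 + D * y.2 ^ 2)).val % 4 = 1 then 64 else 0 := by
    simp only [sub_eq_iff_eq_add]
    exact card_norm_fiber hD (hodd _ _ hc2)
  rw [Nat.card_eq_fintype_card, Fintype.card_subtype, Finset.card_filter, Fintype.sum_prod_type_right]
  simp only [← Finset.card_filter, key]
  rw [← Finset.sum_filter, Finset.sum_const, card_add_two_mul_norm hD hc2]
  norm_num

end NormForm

/-! ### The model `(ℤ/32)[√-d]` of the quotient ring -/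

section Model

theorem conjQ_conjQ (d m : ℤ) (x : Rq d m) : conjQ d m (conjQ d m x) = x := by
  obtain ⟨x, rfl⟩ := Ideal.Quotient.mk_surjective x
  simp [conjQ, Ideal.quotientMap_mk]

/-- The involution of `ℤ[√-d]/(m)` given by conjugation. -/
noncomputable abbrev starRingRq (d m : ℤ) : StarRing (Rq d m) where
  star := conjQ d m
  star_involutive := conjQ_conjQ d m
  star_mul x y := by rw [map_mul, mul_comm]
  star_add := map_add _

variable (d : ℤ)

/-- `(ℤ/32)[√-d]`. -/
abbrev RqModel : Type := QuadraticAlgebra (ZMod 32) (-(d : ZMod 32)) 0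

/-- Coefficientwise reduction `ℤ[√-d] → (ℤ/32)[√-d]`. -/
def toModel : Zsqrtd (-d) →+* RqModel d where
  toFun x := ⟨x.re, x.im⟩
  map_zero' := by ext <;> simp
  map_one' := by ext <;> simp [QuadraticAlgebra.re_one, QuadraticAlgebra.im_one]
  map_add' x y := by ext <;> simp
  map_mul' x y := by
    ext
    · simp
    · simp

theorem toModel_surjective : Function.Surjective (toModel d) := by
  rintro ⟨a, b⟩
  obtain ⟨a, rfl⟩ := ZMod.intCast_surjective a
  obtain ⟨b, rfl⟩ := ZMod.intCast_surjective b
  exact ⟨⟨a, b⟩, rfl⟩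

theorem ker_toModel : Ideal.span {((32 : ℤ) : Zsqrtd (-d))} = RingHom.ker (toModel d) := by
  ext x
  rw [Ideal.mem_span_singleton, Zsqrtd.intCast_dvd, RingHom.mem_ker, QuadraticAlgebra.ext_iff]
  change _ ↔ ((x.re : ℤ) : ZMod 32) = 0 ∧ ((x.im : ℤ) : ZMod 32) = 0
  rw [ZMod.intCast_zmod_eq_zero_iff_dvd, ZMod.intCast_zmod_eq_zero_iff_dvd]
  rfl

/-- `ℤ[√-d]/(32) ≃ (ℤ/32)[√-d]`. -/
noncomputable def rqEquivModel : Rq d 32 ≃+* RqModel d :=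
  (Ideal.quotEquivOfEq (ker_toModel d)).trans
    (RingHom.quotientKerEquivOfSurjective (toModel_surjective d))

theorem rqEquivModel_conjQ (x : Rq d 32) :
    rqEquivModel d (conjQ d 32 x) = star (rqEquivModel d x) := by
  obtain ⟨x, rfl⟩ := Ideal.Quotient.mk_surjective x
  change toModel d (star x) = star (toModel d x)
  ext
  · simp [toModel]
  · simp [toModel]

variable {d}

/-- Reduction of `(ℤ/32)[√-d]` modulo the prime above `2`, for odd `d`. -/
def modelResidue (hd : (d : ZMod 2) = 1) : RqModel d →+* ZMod 2 where
  toFun x := ZMod.castHom (by norm_num : 2 ∣ 32) (ZMod 2) (x.re + x.im)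
  map_zero' := by simp
  map_one' := by simp [QuadraticAlgebra.re_one, QuadraticAlgebra.im_one]
  map_add' x y := by
    rw [← map_add]
    congr 1
    simp
    ring
  map_mul' x y := by
    rw [← map_mul, QuadraticAlgebra.re_mul, QuadraticAlgebra.im_mul]
    simp only [map_add, map_mul, map_neg, map_intCast, hd, map_zero]
    generalize ZMod.castHom _ (ZMod 2) x.re = a
    generalize ZMod.castHom _ (ZMod 2) x.im = b
    generalize ZMod.castHom _ (ZMod 2) y.re = c
    generalize ZMod.castHom _ (ZMod 2) y.im = e
    revert a b c e
    decide

theorem modelResidue_apply (hd : (d : ZMod 2) = 1) (x : RqModel d) :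
    modelResidue hd x = ZMod.castHom (by norm_num : 2 ∣ 32) (ZMod 2) (x.re + x.im) := rfl

theorem val_intCast_mod_four (hd4 : d % 4 = 1) : (d : ZMod 32).val % 4 = 1 := by
  have := ZMod.val_intCast (n := 32) d
  push_cast at this
  omega

instance : Finite (RqModel d) := Finite.of_equiv _ (QuadraticAlgebra.equivProd _ _).symm

instance : Finite (Rq d 32) := Finite.of_equiv _ (rqEquivModel d).symm.toEquiv

/-- The norm data of `ℤ[√-d]/(32)` for `d ≡ 1 (mod 4)`. -/
noncomputable def normDataRq (hd4 : d % 4 = 1) : @NormData (Rq d 32) _ (starRingRq d 32) :=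
  letI := starRingRq d 32
  have hd2 : (d : ZMod 2) = 1 := by
    rw [← Int.cast_one, ZMod.intCast_eq_intCast_iff, Int.ModEq]
    push_cast
    omega
  let eP : Rq d 32 ≃ ZMod 32 × ZMod 32 :=
    (rqEquivModel d).toEquiv.trans (QuadraticAlgebra.equivProd _ _)
  { ρ := (modelResidue hd2).comp (rqEquivModel d : Rq d 32 →+* RqModel d)
    ι := ((rqEquivModel d).symm : RqModel d →+* Rq d 32).comp (algebraMap (ZMod 32) (RqModel d))
    nm := fun x => (rqEquivModel d x).re ^ 2 + d * (rqEquivModel d x).im ^ 2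
    ι_injective := (rqEquivModel d).symm.injective.comp QuadraticAlgebra.algebraMap_injective
    mul_star_eq := fun x => by
      apply (rqEquivModel d).injective
      change rqEquivModel d (x * conjQ d 32 x) =
        rqEquivModel d ((rqEquivModel d).symm (algebraMap (ZMod 32) (RqModel d) _))
      rw [map_mul, rqEquivModel_conjQ, RingEquiv.apply_symm_apply, QuadraticAlgebra.algebraMap_eq]
      ext
      · simp
        ring
      · simp
        ring
    cast_nm := fun x => by
      change _ = modelResidue hd2 (rqEquivModel d x)
      rw [modelResidue_apply]
      have hsq : ∀ a : ZMod 2, a ^ 2 = a := by decide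
      simp only [map_add, map_mul, map_pow, map_intCast, hd2, one_mul, hsq]
    ρ_star := fun x => by
      change modelResidue hd2 (rqEquivModel d (conjQ d 32 x)) = modelResidue hd2 (rqEquivModel d x)
      rw [rqEquivModel_conjQ, modelResidue_apply, modelResidue_apply]
      simp [CharTwo.neg_eq]
    card_fiber := fun s => by
      rw [← natCard_residue_fiber s]
      exact Nat.card_congr (eP.subtypeEquiv fun x => Iff.rfl)
    card_pairs := fun c hc => by
      rw [← card_norm_pairs (val_intCast_mod_four hd4) hc]
      exact Nat.card_congr ((eP.prodCongr eP).subtypeEquiv fun x => Iff.rfl) }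

end Model

/-- For `d ≡ 1 (mod 4)`, the order of `SU(M, ℤ[√-d]/(32))` equals
`2^{5(n+1)²-5} · ∏_{i=1}^{⌊(n-1)/2⌋} (1 - 2^{-2i})`. -/
theorem card_SU_M_mod_32 (d : ℤ) (hd : 0 < d) (hsf : Squarefree d) (hd4 : d % 4 = 1)
    (n : ℕ) (hn : 1 ≤ n) :
    (Nat.card {A : Matrix (Fin (n + 1)) (Fin (n + 1)) (Rq d 32) //
        A * Mmat (Rq d 32) n * (A.map (conjQ d 32))ᵀ = Mmat (Rq d 32) n ∧
        A.det = 1} : ℚ)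
      = 2 ^ (5 * (n + 1) ^ 2 - 5) *
        ∏ i ∈ Finset.Icc 1 ((n - 1) / 2), (1 - (2 : ℚ) ^ (-(2 * (i : ℤ)))) := by
  let _ := starRingRq d 32
  exact (normDataRq hd4).card_specialUnitary n
end

section
/- Let d be a positive odd squarefree integer, n ≥ 1 odd, and p an odd prime with p ∣ d. Let R = ℤ[√-d]/(p) with σ the ring endomorphism induced by conjugation, and let M = diag(1,…,1,-2) of size n+1. Then the number N of matrices A ∈ M_{n+1}(R) with A·M·σ(A)ᵀ = M and det A = 1 satisfies, as rational numbers, N = p^{(n+1)²-1} · (1 - ε·p^{-(n+1)/2}) · ∏_{i=1}^{(n-1)/2} (1 - p^{-2i}), where ε = ((-1)^{(n+3)/2}·2/p) is the Legendre symbol of 2·(-1)^{(n+3)/2} modulo p. -/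
open Matrix

section QuadraticCounting

variable {F : Type*} [Field F] [Fintype F] [DecidableEq F]

theorem sum_comp_sq (hF : ringChar F ≠ 2) (f : F → ℤ) :
    ∑ x, f (x ^ 2) = ∑ y, (quadraticChar F y + 1) * f y := by
  rw [← Finset.sum_fiberwise (s := Finset.univ) (g := fun x : F => x ^ 2)]
  refine Finset.sum_congr rfl fun y _ => ?_
  rw [Finset.sum_congr rfl (g := fun _ => f y)
    (fun x hx => by rw [(Finset.mem_filter.1 hx).2]), Finset.sum_const, nsmul_eq_mul,
    ← quadraticChar_card_sqrts hF y]
  congr 3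
  ext x
  simp

theorem sum_quadraticChar_sub_mul (hF : ringChar F ≠ 2) (c : F) {w : F} (hw : w ≠ 0) :
    ∑ y, quadraticChar F (c - w * y) = 0 := by
  rw [← quadraticChar_sum_zero hF]
  exact Fintype.sum_bijective (fun y => c - w * y)
    ((Equiv.subLeft c).bijective.comp (mulLeft_bijective₀ w hw)) _ _ fun _ => rfl

theorem sum_quadraticChar_sub_mul_sq (hF : ringChar F ≠ 2) (c : F) {w : F} (hw : w ≠ 0) :
    ∑ x, quadraticChar F (c - w * x ^ 2) =
      quadraticChar F (-w) * ((if c = 0 then (Fintype.card F : ℤ) else 0) - 1) := by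
  rw [sum_comp_sq hF fun y => quadraticChar F (c - w * y)]
  simp only [add_mul, one_mul, Finset.sum_add_distrib, sum_quadraticChar_sub_mul hF c hw, add_zero]
  have h1 : ∀ y : F, quadraticChar F y * quadraticChar F (c - w * y) =
      quadraticChar F (c * y⁻¹ - w) - if y = 0 then quadraticChar F (-w) else 0 := by
    intro y
    by_cases hy : y = 0
    · simp [hy]
    · have : y * (c - w * y) = (c * y⁻¹ - w) * y ^ 2 := by field_simp
      rw [← map_mul, this, map_mul, quadraticChar_sq_one' hy]
      simp [hy]
  simp only [h1, Finset.sum_sub_distrib, Finset.sum_ite_eq', Finset.mem_univ, if_true]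
  rw [Fintype.sum_bijective (fun y : F => y⁻¹) inv_involutive.bijective _
    (fun z => quadraticChar F (c * z - w)) fun _ => rfl]
  by_cases hc : c = 0
  · simp [hc]; ring
  · have := sum_quadraticChar_sub_mul hF (-w) (neg_ne_zero.2 hc)
    simp only [neg_mul, sub_neg_eq_add, neg_add_eq_sub] at this
    rw [this, if_neg hc]
    simp

/-- The number of solutions of `Q = c` for a nondegenerate quadratic form `Q` in `m` variables
of determinant `D` over `F`. -/
noncomputable def quadricCount (m : ℕ) (D c : F) : ℚ :=
  if Even m then
    (Fintype.card F : ℚ) ^ m / Fintype.card F + quadraticChar F ((-1) ^ (m / 2) * D) *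
      ((if c = 0 then (Fintype.card F : ℚ) else 0) - 1) * Fintype.card F ^ (m / 2) / Fintype.card F
  else
    (Fintype.card F : ℚ) ^ m / Fintype.card F + quadraticChar F ((-1) ^ (m / 2) * D * c) *
      Fintype.card F ^ (m / 2)

theorem card_diagonal_succ (m : ℕ) (w : Fin (m + 1) → F) (c : F) :
    Fintype.card {x : Fin (m + 1) → F // ∑ i, w i * x i ^ 2 = c} =
      ∑ t : F, Fintype.card {x : Fin m → F // ∑ i, w i.succ * x i ^ 2 = c - w 0 * t ^ 2} := by
  rw [← Fintype.card_sigma]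
  refine Fintype.card_congr
    { toFun := fun x => ⟨x.1 0, Fin.tail x.1, ?_⟩
      invFun := fun y => ⟨Fin.cons y.1 y.2.1, ?_⟩
      left_inv := fun x => ?_
      right_inv := fun y => ?_ }
  · have := x.2
    rw [Fin.sum_univ_succ] at this
    exact eq_sub_of_add_eq' this
  · have := y.2.2
    simp [Fin.sum_univ_succ, this]
  · simp
  · rfl

theorem card_diagonal (hF : ringChar F ≠ 2) (m : ℕ) (w : Fin m → F) (hw : ∀ i, w i ≠ 0) (c : F) :
    (Fintype.card {x : Fin m → F // ∑ i, w i * x i ^ 2 = c} : ℚ) =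
      quadricCount m (∏ i, w i) c := by
  have hq : (Fintype.card F : ℚ) ≠ 0 := by simp
  induction m generalizing c with
  | zero =>
    by_cases hc : c = 0
    · subst hc
      simp [quadricCount]
      field_simp
      ring
    · simp [quadricCount, hc, Ne.symm hc]
      field_simp
      ring
  | succ m ih =>
    rw [card_diagonal_succ]
    push_cast
    simp only [ih (fun i => w i.succ) fun i => hw i.succ]
    rw [Fin.prod_univ_succ]
    set D := ∏ i : Fin m, w i.succ
    obtain ⟨k, rfl | rfl⟩ := Nat.even_or_odd' m
    · have h2 : (2 * k + 1) / 2 = k := by omega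
      have h3 : (∑ t : F, if c - w 0 * t ^ 2 = 0 then (Fintype.card F : ℚ) else 0) =
          Fintype.card F * (quadraticChar F (c * w 0) + 1) := by
        have : ∀ t, c - w 0 * t ^ 2 = 0 ↔ t ^ 2 = c / w 0 := fun t => by
          rw [sub_eq_zero, eq_div_iff (hw 0), mul_comm, eq_comm]
        simp only [this]
        rw [← Finset.sum_filter, Finset.sum_const, nsmul_eq_mul, mul_comm]
        congr 1
        have h4 : quadraticChar F (c * w 0) = quadraticChar F (c / w 0) := by
          have : c * w 0 = c / w 0 * w 0 ^ 2 := by have := hw 0; field_simp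
          rw [this, map_mul, quadraticChar_sq_one' (hw 0), mul_one]
        rw [h4]
        have := quadraticChar_card_sqrts hF (c / w 0)
        have h5 : ((Finset.univ.filter fun t : F => t ^ 2 = c / w 0).card : ℤ) =
            quadraticChar F (c / w 0) + 1 := by
          rw [← this]; congr 2; ext; simp
        exact_mod_cast h5
      simp only [quadricCount, even_two_mul, if_true, h2,
        Nat.not_even_two_mul_add_one, if_false, Nat.mul_div_cancel_left _ two_pos]
      rw [Finset.sum_add_distrib, ← Finset.sum_div _ _ (Fintype.card F : ℚ),
        ← Finset.sum_div _ _ (Fintype.card F : ℚ), ← Finset.sum_mul, ← Finset.mul_sum,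
        Finset.sum_sub_distrib, h3]
      have h6 : (-1) ^ k * (w 0 * D) * c = ((-1) ^ k * D) * (c * w 0) := by ring
      rw [h6, map_mul _ ((-1) ^ k * D)]
      simp
      field_simp
      ring
    · have h2 : (2 * k + 1) / 2 = k := by omega
      have h3 : (2 * k + 1 + 1) / 2 = k + 1 := by omega
      have h4 : Even (2 * k + 1 + 1) := by simp [parity_simps]
      simp only [quadricCount, h4, if_true, h2, h3,
        Nat.not_even_two_mul_add_one, if_false, map_mul _ ((-1) ^ k * D)]
      have h5 : (∑ t : F, (quadraticChar F (c - w 0 * t ^ 2) : ℚ)) =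
          quadraticChar F (-w 0) * ((if c = 0 then (Fintype.card F : ℚ) else 0) - 1) := by
        have := sum_quadraticChar_sub_mul_sq hF c (hw 0)
        exact_mod_cast congrArg (Int.cast : ℤ → ℚ) this
      have h6 : (-1) ^ (k + 1) * (w 0 * D) = ((-1) ^ k * D) * (-w 0) := by ring
      rw [h6, map_mul _ ((-1) ^ k * D)]
      push_cast
      simp only [mul_assoc, Finset.sum_add_distrib, ← Finset.mul_sum, ← Finset.sum_mul]
      rw [h5]
      simp
      field_simp
      ring

end QuadraticCounting

section Congruence

variable {F : Type*} [Field F]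

theorem mul_mul_transpose_apply {m n R : Type*} [Fintype n] [CommRing R] (P : Matrix m n R)
    (G : Matrix n n R) (i j : m) : (P * G * Pᵀ) i j = P i ⬝ᵥ G *ᵥ P j := by
  rw [Matrix.mul_assoc, Matrix.mul_apply']
  congr 1

theorem det_of_basis_ne_zero {m : ℕ} (b : Module.Basis (Fin m) F (Fin m → F)) :
    (Matrix.of b).det ≠ 0 :=
  isUnit_iff_ne_zero.1 ((Matrix.isUnit_iff_isUnit_det _).1
    (Matrix.linearIndependent_rows_iff_isUnit.1 b.linearIndependent))

theorem Matrix.IsSymm.exists_congruent_diagonal {m : ℕ} (h2 : (2 : F) ≠ 0)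
    {G : Matrix (Fin m) (Fin m) F} (hG : G.IsSymm) :
    ∃ (P : Matrix (Fin m) (Fin m) F) (w : Fin m → F),
      P.det ≠ 0 ∧ P * G * Pᵀ = Matrix.diagonal w := by
  have : Invertible (2 : F) := invertibleOfNonzero h2
  obtain ⟨v, hv⟩ := LinearMap.BilinForm.exists_orthogonal_basis
    (LinearMap.BilinForm.isSymm_iff.1 (Matrix.isSymm_toBilin'_iff_isSymm.2 hG))
  let b := v.reindex (finCongr (Module.finrank_fin_fun F))
  refine ⟨Matrix.of b, fun i => b i ⬝ᵥ G *ᵥ b i, det_of_basis_ne_zero b, ?_⟩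
  ext i j
  rw [mul_mul_transpose_apply]
  obtain rfl | hij := eq_or_ne i j
  · simp; rfl
  · rw [Matrix.diagonal_apply_ne _ hij, ← Matrix.toBilin'_apply']
    have := @hv ((finCongr (Module.finrank_fin_fun F)).symm i)
      ((finCongr (Module.finrank_fin_fun F)).symm j) (by simpa using hij)
    change Matrix.toBilin' G (b i) (b j) = 0
    rw [Module.Basis.reindex_apply, Module.Basis.reindex_apply]
    exact this

theorem exists_basis_cons {m : ℕ} {G : Matrix (Fin (m + 1)) (Fin (m + 1)) F}
    {v : Fin (m + 1) → F} (hv : v ⬝ᵥ G *ᵥ v ≠ 0) :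
    ∃ P : Matrix (Fin (m + 1)) (Fin (m + 1)) F, P.det ≠ 0 ∧ P 0 = v ∧
      ∀ i : Fin m, (P * G * Pᵀ) 0 i.succ = 0 := by
  let f : (Fin (m + 1) → F) →ₗ[F] F := Matrix.toBilin' G v
  have hf : ∀ x, f x = v ⬝ᵥ G *ᵥ x := fun x => Matrix.toBilin'_apply' G v x
  have hfv : f v ≠ 0 := by rwa [hf]
  let b := Module.Basis.mkFinCons (N := LinearMap.ker f) v (Module.finBasis F (LinearMap.ker f))
    (fun c x hx h => by
      have := congrArg f h
      simpa [LinearMap.mem_ker.1 hx, hfv] using this)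
    (fun z => ⟨-(f z / f v), by simp [LinearMap.mem_ker, hfv]⟩)
  have hcard := Module.finrank_eq_card_basis b
  simp only [Module.finrank_fin_fun, Fintype.card_fin] at hcard
  let e := finCongr hcard.symm
  refine ⟨Matrix.of (b.reindex e), det_of_basis_ne_zero _, ?_, fun i => ?_⟩
  · ext j
    simp only [Matrix.of_apply, Module.Basis.reindex_apply]
    have : e.symm 0 = 0 := by ext; simp [e]
    rw [this]
    simp [b]
  · rw [mul_mul_transpose_apply]
    have h0 : e.symm 0 = 0 := by ext; simp [e]
    have h1 : e.symm i.succ = Fin.succ (i.cast (by omega)) := by ext; simp [e]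
    have h2 : (Matrix.of (b.reindex e)) 0 = v := by
      change b.reindex e 0 = v
      rw [Module.Basis.reindex_apply, h0]
      simp [b]
    rw [h2, ← hf]
    change f (b.reindex e i.succ) = 0
    rw [Module.Basis.reindex_apply, h1]
    simp [b]

end Congruence

section Bordered

variable {R : Type*} [CommRing R] {m : ℕ}

/-- The block diagonal matrix with blocks `c` and `B`. -/
def bordered (c : R) (B : Matrix (Fin m) (Fin m) R) : Matrix (Fin (m + 1)) (Fin (m + 1)) R :=
  Matrix.of (Fin.cons (Fin.cons c 0) fun i => Fin.cons 0 (B i))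

@[simp]
theorem bordered_zero_zero (c : R) (B : Matrix (Fin m) (Fin m) R) : bordered c B 0 0 = c := rfl

@[simp]
theorem bordered_zero_succ (c : R) (B : Matrix (Fin m) (Fin m) R) (j : Fin m) :
    bordered c B 0 j.succ = 0 := rfl

@[simp]
theorem bordered_succ_zero (c : R) (B : Matrix (Fin m) (Fin m) R) (i : Fin m) :
    bordered c B i.succ 0 = 0 := rfl

@[simp]
theorem bordered_succ_succ (c : R) (B : Matrix (Fin m) (Fin m) R) (i j : Fin m) :
    bordered c B i.succ j.succ = B i j := rfl

theorem bordered_right_injective (c : R) :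
    Function.Injective (bordered c : Matrix (Fin m) (Fin m) R → _) := fun B C h => by
  ext i j
  simpa using congrFun (congrFun h i.succ) j.succ

theorem bordered_mul (c d : R) (B C : Matrix (Fin m) (Fin m) R) :
    bordered c B * bordered d C = bordered (c * d) (B * C) := by
  ext i j
  refine Fin.cases ?_ (fun i => ?_) i <;> refine Fin.cases ?_ (fun j => ?_) j <;>
    simp [Matrix.mul_apply, Fin.sum_univ_succ]

theorem transpose_bordered (c : R) (B : Matrix (Fin m) (Fin m) R) :
    (bordered c B)ᵀ = bordered c Bᵀ := by
  ext i j
  refine Fin.cases ?_ (fun i => ?_) i <;> refine Fin.cases ?_ (fun j => ?_) j <;> simp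

theorem det_bordered (c : R) (B : Matrix (Fin m) (Fin m) R) :
    (bordered c B).det = c * B.det := by
  rw [Matrix.det_succ_row_zero, Fin.sum_univ_succ]
  simp
  rfl

theorem diagonal_eq_bordered (a : Fin (m + 1) → R) :
    Matrix.diagonal a = bordered (a 0) (Matrix.diagonal fun i => a i.succ) := by
  ext i j
  refine Fin.cases ?_ (fun i => ?_) i <;> refine Fin.cases ?_ (fun j => ?_) j <;>
    simp [Matrix.diagonal_apply, Fin.succ_ne_zero, (Fin.succ_ne_zero _).symm]

theorem eq_bordered {A : Matrix (Fin (m + 1)) (Fin (m + 1)) R} (h0 : ∀ j : Fin m, A 0 j.succ = 0)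
    (h1 : ∀ i : Fin m, A i.succ 0 = 0) : A = bordered (A 0 0) (A.submatrix Fin.succ Fin.succ) := by
  ext i j
  refine Fin.cases ?_ (fun i => ?_) i <;> refine Fin.cases ?_ (fun j => ?_) j <;> simp [h0, h1]

theorem isSymm_of_bordered {c : R} {B : Matrix (Fin m) (Fin m) R} (h : (bordered c B).IsSymm) :
    B.IsSymm :=
  bordered_right_injective c ((transpose_bordered c B).symm.trans h)

end Bordered

section Frames

variable {F : Type*} [Field F] [Fintype F] [DecidableEq F]

theorem quadricCount_congr {D D' : F} (h : quadraticChar F D = quadraticChar F D') (m : ℕ)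
    (c : F) : quadricCount m D c = quadricCount m D' c := by
  simp only [quadricCount, map_mul, h]

theorem quadraticChar_sq_mul {x : F} (hx : x ≠ 0) (y : F) :
    quadraticChar F (x ^ 2 * y) = quadraticChar F y := by
  rw [map_mul, quadraticChar_sq_one' hx, one_mul]

theorem det_mul_mul_transpose {m R : Type*} [Fintype m] [DecidableEq m] [CommRing R]
    (P G : Matrix m m R) : (P * G * Pᵀ).det = P.det ^ 2 * G.det := by
  rw [Matrix.det_mul, Matrix.det_mul, Matrix.det_transpose]
  ring

theorem card_quadric (hF : ringChar F ≠ 2) {m : ℕ} {G : Matrix (Fin m) (Fin m) F}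
    (hG : G.IsSymm) (hdet : G.det ≠ 0) (c : F) :
    (Fintype.card {v : Fin m → F // v ⬝ᵥ G *ᵥ v = c} : ℚ) = quadricCount m G.det c := by
  obtain ⟨P, w, hP, hPw⟩ := hG.exists_congruent_diagonal (Ring.two_ne_zero hF)
  have hdw : P.det ^ 2 * G.det = ∏ i, w i := by
    rw [← det_mul_mul_transpose, hPw, Matrix.det_diagonal]
  have hw : ∀ i, w i ≠ 0 := fun i => by
    have : ∏ i, w i ≠ 0 := hdw ▸ mul_ne_zero (pow_ne_zero _ hP) hdet
    exact Finset.prod_ne_zero_iff.1 this i (Finset.mem_univ i)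
  rw [← quadricCount_congr (quadraticChar_sq_mul hP G.det), hdw, ← card_diagonal hF m w hw]
  have hinj : Function.Injective fun x : Fin m → F => x ᵥ* P :=
    Matrix.vecMul_injective_iff_isUnit.2
      ((Matrix.isUnit_iff_isUnit_det _).2 (isUnit_iff_ne_zero.2 hP))
  congr 1
  refine (Fintype.card_congr ((Equiv.ofBijective _
    (Finite.injective_iff_bijective.1 hinj)).subtypeEquiv fun x => ?_)).symm
  have : (x ᵥ* P) ⬝ᵥ G *ᵥ (x ᵥ* P) = ∑ i, w i * x i ^ 2 := by
    rw [← Matrix.dotProduct_mulVec, ← Matrix.mulVec_transpose, Matrix.mulVec_mulVec,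
      Matrix.mulVec_mulVec, hPw]
    refine Finset.sum_congr rfl fun i _ => ?_
    rw [Matrix.mulVec_diagonal]
    ring
  rw [Equiv.ofBijective_apply, this]

/-- The number of matrices `A` with `A * G * Aᵀ = diagonal a` over `F`, for symmetric `G` whose
determinant is `∏ i, a i` up to a nonzero square. -/
noncomputable def frameCount : (m : ℕ) → (Fin m → F) → ℚ
  | 0, _ => 1
  | m + 1, a => quadricCount (m + 1) (∏ i, a i) (a 0) * frameCount m fun i => a i.succ

theorem card_frames_fiber {m : ℕ} {P G : Matrix (Fin (m + 1)) (Fin (m + 1)) F}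
    {G' : Matrix (Fin m) (Fin m) F} {a : Fin (m + 1) → F} (ha : a 0 ≠ 0) (hP : P.det ≠ 0)
    (h : P * G * Pᵀ = bordered (a 0) G') :
    Fintype.card {A : Matrix (Fin m) (Fin m) F // A * G' * Aᵀ = Matrix.diagonal fun i => a i.succ} =
      Fintype.card {A : Matrix (Fin (m + 1)) (Fin (m + 1)) F //
        A * G * Aᵀ = Matrix.diagonal a ∧ A 0 = P 0} := by
  have hPu : IsUnit P.det := isUnit_iff_ne_zero.2 hP
  have hmul : ∀ A, (A * P) * G * (A * P)ᵀ = A * bordered (a 0) G' * Aᵀ := fun A => by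
    simp only [← h, Matrix.transpose_mul, Matrix.mul_assoc]
  refine Fintype.card_congr (Equiv.ofBijective (fun A => ⟨bordered 1 A.1 * P, ?_, ?_⟩) ⟨?_, ?_⟩)
  · rw [hmul, transpose_bordered, bordered_mul, bordered_mul, A.2, diagonal_eq_bordered]
    simp
  · ext j
    simp [Matrix.mul_apply, Fin.sum_univ_succ]
  · intro A B hAB
    have := congrArg (· * P⁻¹) (congrArg Subtype.val hAB)
    simp only [Matrix.mul_nonsing_inv_cancel_right _ _ hPu] at this
    exact Subtype.ext (bordered_right_injective _ this)
  · rintro ⟨A, hA, hA0⟩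
    obtain ⟨B, rfl⟩ : ∃ B, A = B * P := ⟨A * P⁻¹, by
      rw [Matrix.nonsing_inv_mul_cancel_right _ _ hPu]⟩
    have hB0 : B 0 = Pi.single 0 1 := by
      have h1 : B 0 ᵥ* P = Pi.single 0 1 ᵥ* P := by
        rw [Matrix.single_one_vecMul]
        exact hA0
      exact Matrix.vecMul_injective_iff_isUnit.2
        ((Matrix.isUnit_iff_isUnit_det _).2 hPu) h1
    rw [hmul] at hA
    have h00 : B 0 0 = 1 := by simp [hB0]
    have h0 : ∀ j : Fin m, B 0 j.succ = 0 := by simp [hB0]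
    have hBG : ∀ i, (B * bordered (a 0) G' * Bᵀ) i 0 = B i 0 * a 0 := fun i => by
      simp [Matrix.mul_apply, Fin.sum_univ_succ, h00, h0]
    have h1 : ∀ i : Fin m, B i.succ 0 = 0 := fun i => by
      have := hBG i.succ
      rw [hA, Matrix.diagonal_apply_ne _ (Fin.succ_ne_zero i)] at this
      simpa [ha] using this.symm
    have hB := eq_bordered h0 h1
    rw [h00] at hB
    refine ⟨⟨B.submatrix Fin.succ Fin.succ, ?_⟩, Subtype.ext ?_⟩
    · rw [hB, transpose_bordered, bordered_mul, bordered_mul, diagonal_eq_bordered a] at hA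
      simp only [one_mul, mul_one] at hA
      exact bordered_right_injective _ hA
    · exact congrArg (· * P) hB.symm

theorem card_frames (hF : ringChar F ≠ 2) (m : ℕ) {G : Matrix (Fin m) (Fin m) F}
    (hG : G.IsSymm) (hdet : G.det ≠ 0) {a : Fin m → F} (ha : ∀ i, a i ≠ 0)
    (hGa : quadraticChar F G.det = quadraticChar F (∏ i, a i)) :
    (Fintype.card {A : Matrix (Fin m) (Fin m) F // A * G * Aᵀ = Matrix.diagonal a} : ℚ) =
      frameCount m a := by
  induction m with
  | zero =>
    have : Unique {A : Matrix (Fin 0) (Fin 0) F // A * G * Aᵀ = Matrix.diagonal a} :=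
      ⟨⟨⟨1, Subsingleton.elim _ _⟩⟩, fun _ => Subsingleton.elim _ _⟩
    rw [Fintype.card_unique, frameCount, Nat.cast_one]
  | succ m ih =>
    let f : {A : Matrix (Fin (m + 1)) (Fin (m + 1)) F // A * G * Aᵀ = Matrix.diagonal a} →
        {v : Fin (m + 1) → F // v ⬝ᵥ G *ᵥ v = a 0} := fun A => ⟨A.1 0, by
      rw [← mul_mul_transpose_apply, A.2, Matrix.diagonal_apply_eq]⟩
    rw [← Fintype.card_congr (Equiv.sigmaFiberEquiv f), Fintype.card_sigma]
    push_cast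
    rw [Finset.sum_congr rfl (g := fun _ => frameCount m fun i => a i.succ), Finset.sum_const,
      Finset.card_univ, nsmul_eq_mul, card_quadric hF hG hdet, quadricCount_congr hGa, frameCount]
    rintro ⟨v, hv⟩ -
    obtain ⟨P, hP, rfl, hP0⟩ := exists_basis_cons (hv ▸ ha 0)
    have hsymm : (P * G * Pᵀ).IsSymm := by
      rw [Matrix.IsSymm, Matrix.transpose_mul, Matrix.transpose_mul, Matrix.transpose_transpose,
        hG.eq, Matrix.mul_assoc]
    have hQ := eq_bordered hP0 fun i => (hsymm.apply _ _).trans (hP0 i)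
    rw [mul_mul_transpose_apply P G 0 0, hv] at hQ
    set G' := (P * G * Pᵀ).submatrix Fin.succ Fin.succ
    have hG' : G'.IsSymm := isSymm_of_bordered (hQ ▸ hsymm)
    have hd : P.det ^ 2 * G.det = a 0 * G'.det := by
      rw [← det_mul_mul_transpose, hQ, det_bordered]
    have hdet' : G'.det ≠ 0 :=
      right_ne_zero_of_mul (hd ▸ mul_ne_zero (pow_ne_zero _ hP) hdet)
    rw [← ih hG' hdet' (a := fun i => a i.succ) (fun i => ha _), card_frames_fiber (ha 0) hP hQ]
    · congr 1
      refine Fintype.card_congr ((Equiv.subtypeEquivRight fun A => ?_).trans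
        (Equiv.subtypeSubtypeEquivSubtypeInter _ fun A : Matrix _ _ F => A 0 = P 0))
      simp [f]
    · have h0 : quadraticChar F (a 0) ≠ 0 := fun h => ha 0 (quadraticChar_eq_zero_iff.1 h)
      refine mul_left_cancel₀ h0 ?_
      rw [← map_mul, ← map_mul, ← hd, quadraticChar_sq_mul hP, hGa, Fin.prod_univ_succ]

end Frames

section Orthogonal

variable {F : Type*} [Field F] [Fintype F] [DecidableEq F]

/-- The vector `(1, …, 1, δ)`. -/
def lastEntry (n : ℕ) (δ : F) : Fin (n + 1) → F := fun i => if i = Fin.last n then δ else 1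

omit [Fintype F] [DecidableEq F] in
theorem prod_lastEntry (n : ℕ) (δ : F) : ∏ i, lastEntry n δ i = δ := by
  simp [lastEntry]

omit [Fintype F] [DecidableEq F] in
theorem lastEntry_ne_zero (n : ℕ) {δ : F} (hδ : δ ≠ 0) (i : Fin (n + 1)) :
    lastEntry n δ i ≠ 0 := by
  unfold lastEntry
  split_ifs <;> simp [hδ]

theorem frameCount_lastEntry_succ (n : ℕ) (δ : F) :
    frameCount (n + 2) (lastEntry (n + 1) δ) =
      quadricCount (n + 2) δ 1 * frameCount (n + 1) (lastEntry n δ) := by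
  have h0 : lastEntry (n + 1) δ 0 = 1 := if_neg (Fin.last_pos.ne)
  have h1 : (fun i : Fin (n + 1) => lastEntry (n + 1) δ i.succ) = lastEntry n δ := by
    ext i
    simp [lastEntry, ← Fin.succ_last]
  rw [frameCount, prod_lastEntry, h0, h1]

theorem frameCount_lastEntry_zero {δ : F} (hδ : δ ≠ 0) : frameCount 1 (lastEntry 0 δ) = 2 := by
  have h0 : lastEntry 0 δ 0 = δ := if_pos rfl
  have hq : (Fintype.card F : ℚ) ≠ 0 := by simp
  rw [frameCount, frameCount, prod_lastEntry, h0, quadricCount, if_neg (by decide)]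
  have : quadraticChar F ((-1) ^ (1 / 2) * δ * δ) = 1 := by
    rw [show 1 / 2 = 0 from rfl, pow_zero, one_mul, ← pow_two, quadraticChar_sq_one' hδ]
  rw [this, pow_one, div_self hq]
  norm_num

theorem quadricCount_even (k : ℕ) (δ : F) :
    quadricCount (2 * k + 2) δ 1 = (Fintype.card F : ℚ) ^ (2 * k + 1) -
      quadraticChar F ((-1) ^ (k + 1) * δ) * Fintype.card F ^ k := by
  have hq : (Fintype.card F : ℚ) ≠ 0 := by simp
  rw [quadricCount, if_pos (by simp [parity_simps]), if_neg one_ne_zero,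
    show (2 * k + 2) / 2 = k + 1 by omega]
  field_simp
  ring

theorem quadricCount_odd (k : ℕ) (δ : F) :
    quadricCount (2 * k + 1) δ 1 = (Fintype.card F : ℚ) ^ (2 * k) +
      quadraticChar F ((-1) ^ k * δ) * Fintype.card F ^ k := by
  have hq : (Fintype.card F : ℚ) ≠ 0 := by simp
  rw [quadricCount, if_neg (by simp [parity_simps]), show (2 * k + 1) / 2 = k by omega, mul_one]
  field_simp
  ring

theorem frameCount_lastEntry_odd {δ : F} (hδ : δ ≠ 0) (k : ℕ) :
    frameCount (2 * k + 2) (lastEntry (2 * k + 1) δ) =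
      2 * (Fintype.card F : ℚ) ^ ((k + 1) * (2 * k + 1)) *
        (1 - quadraticChar F ((-1) ^ (k + 1) * δ) * ((Fintype.card F : ℚ) ^ (k + 1))⁻¹) *
        ∏ i ∈ Finset.Icc 1 k, (1 - ((Fintype.card F : ℚ) ^ (2 * i))⁻¹) := by
  have hq : (Fintype.card F : ℚ) ≠ 0 := by simp
  induction k with
  | zero =>
    rw [frameCount_lastEntry_succ, frameCount_lastEntry_zero hδ, quadricCount_even 0]
    simp
    field_simp
  | succ k ih =>
    have hrec : frameCount (2 * (k + 1) + 2) (lastEntry (2 * (k + 1) + 1) δ) =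
        quadricCount (2 * (k + 1) + 2) δ 1 * (quadricCount (2 * (k + 1) + 1) δ 1 *
          frameCount (2 * k + 2) (lastEntry (2 * k + 1) δ)) :=
      (frameCount_lastEntry_succ (2 * k + 2) δ).trans
        (congrArg _ (frameCount_lastEntry_succ (2 * k + 1) δ))
    rw [hrec, ih, quadricCount_even, quadricCount_odd, Finset.prod_Icc_succ_top (by omega)]
    have hη : (quadraticChar F ((-1) ^ (k + 1) * δ) : ℚ) ^ 2 = 1 := by
      have hne : (-1 : F) ^ (k + 1) * δ ≠ 0 := mul_ne_zero (pow_ne_zero _ (by simp)) hδ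
      rw [← Int.cast_pow, quadraticChar_sq_one hne, Int.cast_one]
    set η : ℚ := ((quadraticChar F ((-1) ^ (k + 1) * δ) : ℤ) : ℚ)
    set q := (Fintype.card F : ℚ)
    set Q := ∏ i ∈ Finset.Icc 1 k, (1 - (q ^ (2 * i))⁻¹)
    have key : (q ^ (2 * (k + 1)) + η * q ^ (k + 1)) * (1 - η * (q ^ (k + 1))⁻¹) =
        q ^ (2 * (k + 1)) * (1 - (q ^ (2 * (k + 1)))⁻¹) := by
      field_simp
      linear_combination (-q ^ (k + 1)) * hη
    have key2 : ∀ ζ : ℚ, q ^ (2 * (k + 1) + 1) - ζ * q ^ (k + 1) =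
        q ^ (2 * (k + 1) + 1) * (1 - ζ * (q ^ (k + 1 + 1))⁻¹) := fun ζ => by
      field_simp
      ring
    rw [key2]
    have hexp : (k + 1 + 1) * (2 * (k + 1) + 1) =
        (2 * (k + 1) + 1) + 2 * (k + 1) + (k + 1) * (2 * k + 1) := by ring
    generalize ((quadraticChar F ((-1) ^ (k + 1 + 1) * δ) : ℤ) : ℚ) = ζ
    rw [hexp, pow_add, pow_add]
    linear_combination (q ^ (2 * (k + 1) + 1) * (1 - ζ * (q ^ (k + 1 + 1))⁻¹) * 2 *
      q ^ ((k + 1) * (2 * k + 1)) * Q) * key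

theorem two_mul_card_special_orthogonal (hF : ringChar F ≠ 2) {n : ℕ} {a : Fin (n + 1) → F}
    (ha : ∀ i, a i ≠ 0) :
    2 * Fintype.card {A : Matrix (Fin (n + 1)) (Fin (n + 1)) F //
        A * Matrix.diagonal a * Aᵀ = Matrix.diagonal a ∧ A.det = 1} =
      Fintype.card {A : Matrix (Fin (n + 1)) (Fin (n + 1)) F //
        A * Matrix.diagonal a * Aᵀ = Matrix.diagonal a} := by
  set M := Matrix.diagonal a
  have hMdet : M.det ≠ 0 := by
    rw [Matrix.det_diagonal]
    exact Finset.prod_ne_zero_iff.2 fun i _ => ha i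
  let D : Matrix (Fin (n + 1)) (Fin (n + 1)) F := bordered (-1) 1
  have hDD : D * D = 1 := by
    rw [bordered_mul, ← Matrix.diagonal_one, ← Matrix.diagonal_one, diagonal_eq_bordered]
    simp
  have hDM : D * M * Dᵀ = M := by
    simp only [D, M, diagonal_eq_bordered a, transpose_bordered, bordered_mul]
    simp
  have hDdet : D.det = -1 := by simp [D, det_bordered]
  have hinv : ∀ A, A * M * Aᵀ = M → (D * A) * M * (D * A)ᵀ = M := fun A hA => by
    calc (D * A) * M * (D * A)ᵀ = D * (A * M * Aᵀ) * Dᵀ := by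
          simp only [Matrix.transpose_mul, Matrix.mul_assoc]
      _ = M := by rw [hA, hDM]
  have hdet : ∀ A, A * M * Aᵀ = M → A.det = 1 ∨ A.det = -1 := fun A hA => by
    have := congrArg Matrix.det hA
    rw [det_mul_mul_transpose, mul_eq_right₀ hMdet] at this
    exact mul_self_eq_one_iff.1 (by rw [← pow_two, this])
  have hne : (1 : F) ≠ -1 := (Ring.neg_one_ne_one_of_char_ne_two hF).symm
  have e : {A : {A : Matrix (Fin (n + 1)) (Fin (n + 1)) F // A * M * Aᵀ = M} // A.1.det = 1} ≃
      {A : {A : Matrix (Fin (n + 1)) (Fin (n + 1)) F // A * M * Aᵀ = M} // ¬ A.1.det = 1} :=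
    { toFun := fun A => ⟨⟨D * A.1.1, hinv _ A.1.2⟩, by
        simp [Matrix.det_mul, hDdet, A.2, hne.symm]⟩
      invFun := fun A => ⟨⟨D * A.1.1, hinv _ A.1.2⟩, by
        simp [Matrix.det_mul, hDdet, (hdet _ A.1.2).resolve_left A.2]⟩
      left_inv := fun A => by
        ext1; ext1
        simp [← Matrix.mul_assoc, hDD]
      right_inv := fun A => by
        ext1; ext1
        simp [← Matrix.mul_assoc, hDD] }
  rw [← Fintype.card_congr (Equiv.sumCompl
    fun A : {A : Matrix (Fin (n + 1)) (Fin (n + 1)) F // A * M * Aᵀ = M} => A.1.det = 1),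
    Fintype.card_sum, ← Fintype.card_congr e, ← two_mul]
  congr 1
  exact (Fintype.card_congr (Equiv.subtypeSubtypeEquivSubtypeInter _
    fun A : Matrix (Fin (n + 1)) (Fin (n + 1)) F => A.det = 1)).symm

end Orthogonal

section SelfAdjoint

variable {F : Type*} [Field F] [Fintype F] [DecidableEq F]

theorem card_sum_eq_zero (n : ℕ) :
    Fintype.card {y : Fin (n + 1) → F // ∑ i, y i = 0} = Fintype.card F ^ n := by
  rw [← Fintype.card_fin n, ← Fintype.card_fun, Fintype.card_fin]
  refine Fintype.card_congr
    { toFun := fun y => Fin.tail y.1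
      invFun := fun z => ⟨Fin.cons (-∑ i, z i) z, by simp [Fin.sum_univ_succ]⟩
      left_inv := fun y => Subtype.ext ?_
      right_inv := fun z => by simp }
  have := y.2
  rw [Fin.sum_univ_succ] at this
  conv_rhs => rw [← Fin.cons_self_tail y.1]
  rw [eq_neg_of_add_eq_zero_left this]
  rfl

theorem card_fin_lt (m : ℕ) :
    Fintype.card {p : Fin m × Fin m // p.1 < p.2} = m * (m - 1) / 2 := by
  rw [Fintype.card_subtype, Finset.card_filter, Fintype.sum_prod_type_right]
  rw [← Finset.sum_range_id_mul_two, Nat.mul_div_cancel _ two_pos, Finset.sum_range]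
  refine Finset.sum_congr rfl fun i _ => ?_
  rw [← Finset.card_filter fun x => x < i]
  convert Fin.card_Iio i
  ext
  simp

theorem card_trace_zero_selfAdjoint {n : ℕ} {a : Fin (n + 1) → F} (ha : ∀ i, a i ≠ 0) :
    Fintype.card {X : Matrix (Fin (n + 1)) (Fin (n + 1)) F //
      X * Matrix.diagonal a = Matrix.diagonal a * Xᵀ ∧ X.trace = 0} =
      Fintype.card F ^ (n + (n + 1) * n / 2) := by
  have h : (n + 1) * n / 2 = Fintype.card {p : Fin (n + 1) × Fin (n + 1) // p.1 < p.2} :=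
    (card_fin_lt (n + 1)).symm
  rw [pow_add, ← card_sum_eq_zero, h, ← Fintype.card_fun, ← Fintype.card_prod]
  have hiff : ∀ X : Matrix (Fin (n + 1)) (Fin (n + 1)) F,
      X * Matrix.diagonal a = Matrix.diagonal a * Xᵀ ↔ ∀ i j, X i j * a j = a i * X j i :=
    fun X => by simp [← Matrix.ext_iff]
  refine Fintype.card_congr
    { toFun := fun X => (⟨fun i => X.1 i i, X.2.2⟩, fun p => X.1 p.1.1 p.1.2)
      invFun := fun y => ⟨Matrix.of fun i j => if h : i < j then y.2 ⟨(i, j), h⟩ else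
        if h : j < i then a i * y.2 ⟨(j, i), h⟩ / a j else y.1.1 i, ?_, ?_⟩
      left_inv := fun X => ?_
      right_inv := fun y => ?_ }
  · rw [hiff]
    intro i j
    have := ha i
    have := ha j
    rcases lt_trichotomy i j with hij | rfl | hij
    · simp only [Matrix.of_apply, dif_pos hij, dif_neg hij.not_gt]
      field_simp
    · simp [mul_comm]
    · simp only [Matrix.of_apply, dif_pos hij, dif_neg hij.not_gt]
      field_simp
  · simpa [Matrix.trace] using y.1.2
  · ext i j
    have hX := (hiff _).1 X.2.1 i j
    have := ha j
    rcases lt_trichotomy i j with hij | rfl | hij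
    · simp [hij]
    · simp
    · simp only [Matrix.of_apply, dif_pos hij, dif_neg hij.not_gt]
      field_simp
      rw [← hX, mul_comm]
  · refine Prod.ext (Subtype.ext ?_) ?_
    · ext i
      simp
    · ext p
      simp [p.2]

end SelfAdjoint

section DualNumbers

open TrivSqZeroExt

variable {F : Type*} [Field F]

/-- The conjugation `a + bε ↦ a - bε` of the dual numbers. -/
def dualConj (F : Type*) [Field F] : DualNumber F →+* DualNumber F :=
  (TrivSqZeroExt.map (-LinearMap.id : F →ₗ[F] F)).toRingHom

@[simp]
theorem fst_dualConj (x : DualNumber F) : (dualConj F x).fst = x.fst :=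
  TrivSqZeroExt.fst_map _ x

@[simp]
theorem snd_dualConj (x : DualNumber F) : (dualConj F x).snd = -x.snd :=
  TrivSqZeroExt.snd_map _ x

variable {m : Type*} [Fintype m] [DecidableEq m]

/-- The matrix `B + Cε` over the dual numbers. -/
def dualMatrix (B C : Matrix m m F) : Matrix m m (DualNumber F) :=
  Matrix.of fun i j => inl (B i j) + inr (C i j)

omit [Fintype m] [DecidableEq m] in
@[simp]
theorem fst_dualMatrix (B C : Matrix m m F) (i j : m) : (dualMatrix B C i j).fst = B i j := by
  simp [dualMatrix]

omit [Fintype m] [DecidableEq m] in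
@[simp]
theorem snd_dualMatrix (B C : Matrix m m F) (i j : m) : (dualMatrix B C i j).snd = C i j := by
  simp [dualMatrix]

omit [Fintype m] [DecidableEq m] in
theorem dualMatrix_inj {B C B' C' : Matrix m m F} :
    dualMatrix B C = dualMatrix B' C' ↔ B = B' ∧ C = C' := by
  simp only [← Matrix.ext_iff, TrivSqZeroExt.ext_iff, fst_dualMatrix, snd_dualMatrix, forall_and]

omit [Fintype m] [DecidableEq m] in
theorem exists_eq_dualMatrix (A : Matrix m m (DualNumber F)) : ∃ B C, A = dualMatrix B C :=
  ⟨A.map fst, A.map snd, by ext <;> simp⟩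

omit [DecidableEq m] in
theorem dualMatrix_mul (B C B' C' : Matrix m m F) :
    dualMatrix B C * dualMatrix B' C' = dualMatrix (B * B') (B * C' + C * B') := by
  ext i j
  · simp [Matrix.mul_apply, fst_sum]
  · simp [Matrix.mul_apply, snd_sum, Finset.sum_add_distrib]

omit [Fintype m] [DecidableEq m] in
theorem transpose_map_dualConj_dualMatrix (B C : Matrix m m F) :
    ((dualMatrix B C).map (dualConj F))ᵀ = dualMatrix Bᵀ (-Cᵀ) := by
  ext <;> simp

theorem det_dualMatrix_zero (B : Matrix m m F) : (dualMatrix B 0).det = inl B.det := by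
  have : dualMatrix B 0 = (inlHom F F).mapMatrix B := by ext <;> simp
  rw [this, ← RingHom.map_det]
  rfl

theorem det_dualMatrix_one (X : Matrix m m F) :
    (dualMatrix 1 X).det = 1 + inr X.trace := by
  have h : dualMatrix 1 X = 1 + (DualNumber.eps : DualNumber F) • (inlHom F F).mapMatrix X := by
    ext i j
    · obtain rfl | hij := eq_or_ne i j
      · simp
      · simp [hij]
    · obtain rfl | hij := eq_or_ne i j
      · simp
      · simp [hij]
  have ht : ((inlHom F F).mapMatrix X).trace = inl X.trace := by
    exact (AddMonoidHom.map_trace (inlHom F F) X).symm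
  rw [h, Matrix.det_one_add_smul, pow_two, DualNumber.eps_mul_eps, mul_zero, add_zero, ht]
  ext <;> simp

theorem det_dualMatrix_mul (B X : Matrix m m F) :
    (dualMatrix B (B * X)).det = inl B.det + inr (B.det * X.trace) := by
  have h : dualMatrix B (B * X) = dualMatrix B 0 * dualMatrix 1 X := by
    simp [dualMatrix_mul]
  rw [h, Matrix.det_mul, det_dualMatrix_zero, det_dualMatrix_one]
  ext <;> simp

theorem unitary_dualMatrix_iff (a : m → F) {B X : Matrix m m F} :
    (dualMatrix B (B * X) * dualMatrix (Matrix.diagonal a) 0 *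
        ((dualMatrix B (B * X)).map (dualConj F))ᵀ = dualMatrix (Matrix.diagonal a) 0 ∧
      (dualMatrix B (B * X)).det = 1) ↔
    (B * Matrix.diagonal a * Bᵀ = Matrix.diagonal a ∧ B.det = 1) ∧
      (X * Matrix.diagonal a = Matrix.diagonal a * Xᵀ ∧ X.trace = 0) := by
  set M := Matrix.diagonal a
  have hdet : (dualMatrix B (B * X)).det = 1 ↔ B.det = 1 ∧ X.trace = 0 := by
    rw [det_dualMatrix_mul, TrivSqZeroExt.ext_iff]
    simp only [fst_add, fst_inl, fst_inr, add_zero, fst_one, snd_add, snd_inl, snd_inr, zero_add,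
      snd_one]
    exact and_congr_right fun h => by rw [h, one_mul]
  have hsub : B * M * -(B * X)ᵀ + (B * 0 + B * X * M) * Bᵀ = B * (X * M - M * Xᵀ) * Bᵀ := by
    simp only [Matrix.transpose_mul, Matrix.mul_assoc, Matrix.mul_sub, Matrix.sub_mul,
      Matrix.mul_neg, Matrix.mul_zero, zero_add]
    abel
  rw [hdet, transpose_map_dualConj_dualMatrix, dualMatrix_mul, dualMatrix_mul, dualMatrix_inj, hsub]
  have key : B.det = 1 → (B * (X * M - M * Xᵀ) * Bᵀ = 0 ↔ X * M = M * Xᵀ) := fun h => by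
    have hB : IsUnit B := (Matrix.isUnit_iff_isUnit_det _).2 (h ▸ isUnit_one)
    have hBt : IsUnit Bᵀ := (Matrix.isUnit_iff_isUnit_det _).2
      (by rw [Matrix.det_transpose, h]; exact isUnit_one)
    rw [hBt.mul_left_eq_zero, hB.mul_right_eq_zero, sub_eq_zero]
  tauto

theorem card_special_unitary_dualNumber (a : m → F) :
    Nat.card {A : Matrix m m (DualNumber F) //
        A * dualMatrix (Matrix.diagonal a) 0 * (A.map (dualConj F))ᵀ =
          dualMatrix (Matrix.diagonal a) 0 ∧ A.det = 1} =
      Nat.card {B : Matrix m m F //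
        B * Matrix.diagonal a * Bᵀ = Matrix.diagonal a ∧ B.det = 1} *
      Nat.card {X : Matrix m m F //
        X * Matrix.diagonal a = Matrix.diagonal a * Xᵀ ∧ X.trace = 0} := by
  rw [← Nat.card_prod]
  refine (Nat.card_congr (Equiv.ofBijective (fun p => ⟨dualMatrix p.1.1 (p.1.1 * p.2.1),
    (unitary_dualMatrix_iff a).2 ⟨p.1.2, p.2.2⟩⟩) ⟨?_, ?_⟩)).symm
  · rintro ⟨⟨B, hB⟩, X, hX⟩ ⟨⟨B', hB'⟩, X', hX'⟩ h
    obtain ⟨rfl, h⟩ := dualMatrix_inj.1 (congrArg Subtype.val h)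
    have hBu : IsUnit B.det := by
      rw [hB.2]
      exact isUnit_one
    obtain rfl := ((Matrix.isUnit_iff_isUnit_det _).2 hBu).mul_left_cancel h
    rfl
  · rintro ⟨A, hA⟩
    obtain ⟨B, C, rfl⟩ := exists_eq_dualMatrix A
    have hB : IsUnit B.det := by
      have h := congrArg (fstHom F F F) hA.2
      rw [AlgHom.map_det] at h
      have hm : (fstHom F F F).mapMatrix (dualMatrix B C) = B := by ext; simp
      rw [hm, map_one] at h
      exact h ▸ isUnit_one
    obtain ⟨X, rfl⟩ : ∃ X, C = B * X := ⟨B⁻¹ * C, by rw [Matrix.mul_nonsing_inv_cancel_left _ _ hB]⟩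
    obtain ⟨h1, h2⟩ := (unitary_dualMatrix_iff a).1 hA
    exact ⟨(⟨B, h1⟩, ⟨X, h2⟩), rfl⟩

end DualNumbers

section Ramified

open TrivSqZeroExt

theorem exists_ringEquiv_dualNumber (d : ℤ) (p : ℕ) [Fact p.Prime] (hpd : (p : ℤ) ∣ d) :
    ∃ e : Rq d p ≃+* DualNumber (ZMod p), ∀ x, e (conjQ d p x) = dualConj (ZMod p) (e x) := by
  have hd : ((-d : ℤ) : DualNumber (ZMod p)) = 0 := by
    have h0 : ((-d : ℤ) : ZMod p) = 0 := (ZMod.intCast_zmod_eq_zero_iff_dvd _ _).2 (dvd_neg.2 hpd)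
    ext <;> simp [-Int.cast_neg, h0]
  let φ : Zsqrtd (-d) →+* DualNumber (ZMod p) :=
    Zsqrtd.lift ⟨DualNumber.eps, by rw [DualNumber.eps_mul_eps, hd]⟩
  have hφ1 : ∀ x, (φ x).fst = (x.re : ZMod p) := fun x => by simp [φ]
  have hφ2 : ∀ x, (φ x).snd = (x.im : ZMod p) := fun x => by simp [φ]
  have hker : ∀ x, φ x = 0 ↔ x ∈ Ideal.span {((p : ℤ) : Zsqrtd (-d))} := fun x => by
    rw [Ideal.mem_span_singleton, Zsqrtd.intCast_dvd, TrivSqZeroExt.ext_iff, hφ1, hφ2, fst_zero,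
      snd_zero, ZMod.intCast_zmod_eq_zero_iff_dvd, ZMod.intCast_zmod_eq_zero_iff_dvd]
  let ψ : Rq d p →+* DualNumber (ZMod p) :=
    Ideal.Quotient.lift _ φ fun x hx => (hker x).2 hx
  have hψ : ∀ x, ψ (Ideal.Quotient.mk _ x) = φ x := fun x => Ideal.Quotient.lift_mk _ _ _
  refine ⟨RingEquiv.ofBijective ψ ⟨(injective_iff_map_eq_zero ψ).2 fun x hx => ?_, fun y => ?_⟩,
    fun x => ?_⟩
  · obtain ⟨x, rfl⟩ := Ideal.Quotient.mk_surjective x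
    rw [hψ, hker] at hx
    exact Ideal.Quotient.eq_zero_iff_mem.2 hx
  · obtain ⟨r, hr⟩ := ZMod.intCast_surjective y.fst
    obtain ⟨s, hs⟩ := ZMod.intCast_surjective y.snd
    refine ⟨Ideal.Quotient.mk _ ⟨r, s⟩, ?_⟩
    rw [hψ]
    ext
    · rw [hφ1, hr]
    · rw [hφ2, hs]
  · obtain ⟨x, rfl⟩ := Ideal.Quotient.mk_surjective x
    change ψ (Ideal.Quotient.mk _ (star x)) = dualConj (ZMod p) (ψ (Ideal.Quotient.mk _ x))
    rw [hψ, hψ]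
    ext
    · rw [fst_dualConj, hφ1, hφ1, Zsqrtd.re_star]
    · rw [snd_dualConj, hφ2, hφ2, Zsqrtd.im_star, Int.cast_neg]

theorem card_special_unitary_eq_s17 (d : ℤ) (n p : ℕ) [Fact p.Prime] (hpd : (p : ℤ) ∣ d) :
    Nat.card {A : Matrix (Fin (n + 1)) (Fin (n + 1)) (Rq d p) //
        A * Mmat (Rq d p) n * (A.map (conjQ d p))ᵀ = Mmat (Rq d p) n ∧ A.det = 1} =
      Nat.card {A : Matrix (Fin (n + 1)) (Fin (n + 1)) (DualNumber (ZMod p)) //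
        A * dualMatrix (Matrix.diagonal (lastEntry n (-2 : ZMod p))) 0 *
          (A.map (dualConj (ZMod p)))ᵀ =
          dualMatrix (Matrix.diagonal (lastEntry n (-2 : ZMod p))) 0 ∧ A.det = 1} := by
  obtain ⟨e, he⟩ := exists_ringEquiv_dualNumber d p hpd
  have hM : dualMatrix (Matrix.diagonal (lastEntry n (-2 : ZMod p))) 0 =
      e.mapMatrix (Mmat (Rq d p) n) := by
    have h2 : e 2 = 2 := map_ofNat e 2
    have h3 : (2 : DualNumber (ZMod p)) = inl 2 := (map_ofNat (inlHom (ZMod p) (ZMod p)) 2).symm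
    have h1 : e.mapMatrix (Mmat (Rq d p) n) = Mmat (DualNumber (ZMod p)) n := by
      ext1 i j
      simp only [Mmat, RingEquiv.mapMatrix_apply, Matrix.map_apply, Matrix.diagonal_apply]
      split_ifs <;> simp [h2]
    rw [h1]
    ext i j <;> simp only [Mmat, fst_dualMatrix, snd_dualMatrix, Matrix.diagonal_apply, lastEntry,
      Matrix.zero_apply] <;> split_ifs <;> simp [h3]
  rw [hM]
  refine Nat.card_congr (e.mapMatrix.toEquiv.subtypeEquiv fun A => and_congr ?_ ?_)
  · have hA : ((e.mapMatrix A).map (dualConj (ZMod p)))ᵀ =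
        e.mapMatrix ((A.map (conjQ d p))ᵀ) := by
      ext1 i j
      exact (he _).symm
    change _ ↔ e.mapMatrix A * _ * ((e.mapMatrix A).map (dualConj (ZMod p)))ᵀ = _
    rw [hA, ← map_mul, ← map_mul, e.mapMatrix.injective.eq_iff]
  · change _ ↔ (e.mapMatrix A).det = 1
    rw [← RingEquiv.map_det, map_eq_one_iff e e.injective]

end Ramified

/-- For `n` odd and an odd ramified prime `p ∣ d`, the order of `SU(M, ℤ[√-d]/(p))`
equals `p^{(n+1)²-1} · (1 - ε·p^{-(n+1)/2}) · ∏_{i=1}^{(n-1)/2} (1 - p^{-2i})`, where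
`ε = (2·(-1)^{(n+3)/2} / p)` is a Legendre symbol. -/
theorem card_SU_M_mod_p_ramified_odd (d : ℤ) (hd : 0 < d) (hodd : Odd d)
    (hsf : Squarefree d) (n : ℕ) (hn : 1 ≤ n) (hnodd : Odd n)
    (p : ℕ) [Fact p.Prime] (hp2 : p ≠ 2) (hpd : (p : ℤ) ∣ d) :
    (Nat.card {A : Matrix (Fin (n + 1)) (Fin (n + 1)) (Rq d p) //
        A * Mmat (Rq d p) n * (A.map (conjQ d p))ᵀ = Mmat (Rq d p) n ∧
        A.det = 1} : ℚ)
      = (p : ℚ) ^ ((n + 1) ^ 2 - 1) *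
        (1 - (legendreSym p ((-1) ^ ((n + 3) / 2) * 2) : ℚ) *
          (p : ℚ) ^ (-(((n + 1) / 2 : ℕ) : ℤ))) *
        ∏ i ∈ Finset.Icc 1 ((n - 1) / 2), (1 - (p : ℚ) ^ (-(2 * (i : ℤ)))) := by
  obtain ⟨k, rfl⟩ := hnodd
  have hF : ringChar (ZMod p) ≠ 2 := by rwa [ZMod.ringChar_zmod_n]
  have hδ : (-2 : ZMod p) ≠ 0 := neg_ne_zero.2 (Ring.two_ne_zero hF)
  have ha := lastEntry_ne_zero (2 * k + 1) hδ
  have hO := card_frames hF (2 * k + 1 + 1) (Matrix.isSymm_diagonal (lastEntry (2 * k + 1) (-2)))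
    (by rw [Matrix.det_diagonal]; exact Finset.prod_ne_zero_iff.2 fun i _ => ha i) ha
    (by rw [Matrix.det_diagonal])
  rw [← two_mul_card_special_orthogonal hF ha, frameCount_lastEntry_odd hδ, ZMod.card,
    Nat.cast_mul, Nat.cast_two, mul_assoc, mul_assoc, mul_right_inj' two_ne_zero] at hO
  rw [card_special_unitary_eq_s17 d _ p hpd, card_special_unitary_dualNumber, Nat.card_eq_fintype_card,
    Nat.card_eq_fintype_card, card_trace_zero_selfAdjoint ha, Nat.cast_mul, hO, ZMod.card]
  have h1 : (2 * k + 1 + 3) / 2 = k + 2 := by omega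
  have h2 : (2 * k + 1 + 1) / 2 = k + 1 := by omega
  have h3 : (2 * k + 1 - 1) / 2 = k := by omega
  have h4 : (2 * k + 1 + 1) * (2 * k + 1) / 2 = (k + 1) * (2 * k + 1) := by
    rw [show (2 * k + 1 + 1) * (2 * k + 1) = (k + 1) * (2 * k + 1) * 2 by ring,
      Nat.mul_div_cancel _ two_pos]
  have h5 : (2 * k + 1 + 1) ^ 2 - 1 =
      (k + 1) * (2 * k + 1) + (2 * k + 1 + (k + 1) * (2 * k + 1)) := by
    rw [Nat.sub_eq_iff_eq_add (Nat.one_le_pow _ _ (by omega))]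
    ring
  have h6 : legendreSym p ((-1) ^ (k + 2) * 2) =
      quadraticChar (ZMod p) ((-1) ^ (k + 1) * (-2)) := by
    rw [legendreSym]
    congr 1
    push_cast
    ring
  rw [h1, h2, h3, h4, h5, h6, pow_add]
  simp only [_root_.zpow_neg, _root_.zpow_natCast]
  have h7 : ∀ i : ℕ, (p : ℚ) ^ (2 * (i : ℤ)) = (p : ℚ) ^ (2 * i) := fun i => by
    exact_mod_cast _root_.zpow_natCast (p : ℚ) (2 * i)
  simp only [h7]
  push_cast
  ring
end
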